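/- arXiv:2003.13857 — 5 statements merged into one kernel-verified Lean document; each statement's English description precedes it below -/
import Mathlib

section
/- Let n ≥ 2 and let χ, α, Y, M₀, C̃₀, ℛ₁, T and the flow Φ be as in the context. For v ∈ S^n, t ∈ [0,T] and p ∈ ℝ^{n+1}, let JΦ(t,p,v) = √(det(b_{ij})), where b_{ij} = (∇_pΦ(t,p)τ_i)·(∇_pΦ(t,p)τ_j) for an orthonormal basis (τ₁,…,τ_n) of the hyperplane v^⊥ = {w ∈ ℝ^{n+1} : w·v = 0} (this value does not depend on the choice of basis). Then JΦ(0,p,v) = 1 for all p and v, and there is a constant C̃₃ > 0, depending only on n, ℛ₁, M₀, C̃₀ and T, such that for all t ∈ [0,T], p ∈ ℝ^{n+1} and v ∈ S^n: | JΦ(t,p,v) − 1 − t(div Y(p) − (∇Y(p)v)·v) | ≤ C̃₃ t² (1+|p|)^{-2}, where div Y(p) is the trace of ∇Y(p). -/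
noncomputable section

open Set Metric Real Filter
open scoped RealInnerProductSpace

/-- `ℝ^{n+1}` as a Euclidean space. -/
abbrev Euc (n : ℕ) : Type := EuclideanSpace ℝ (Fin (n + 1))

/-- The unit sphere `𝕊ⁿ ⊆ ℝ^{n+1}`. -/
def Sph (n : ℕ) : Set (Euc n) := Metric.sphere (0 : Euc n) 1


lemma sqrt_aux (x : ℝ) (hx : -1 ≤ x) : |√(1 + x) - 1 - x / 2| ≤ x ^ 2 / 2 := by
  have h1 := Real.sqrt_nonneg (1 + x)
  have h2 := Real.sq_sqrt (show 0 ≤ 1 + x by linarith)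
  set s := √(1 + x)
  have hx' : x = s ^ 2 - 1 := by linarith
  have : s - 1 - x / 2 = - ((s - 1) ^ 2 / 2) := by rw [hx']; ring
  rw [this, abs_neg, abs_of_nonneg (by positivity), hx']
  nlinarith [mul_nonneg (sq_nonneg (s - 1)) (show 0 ≤ s ^ 2 + 2 * s by positivity)]

lemma prod_aux {ι : Type*} [DecidableEq ι] (R : ℝ) (hR : 0 ≤ R) (S : Finset ι) :
    ∃ C : ℝ, 0 ≤ C ∧ ∀ (x : ι → ℝ) (ε : ℝ), 0 ≤ ε → ε ≤ R → (∀ i, |x i| ≤ ε) →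
      |∏ i ∈ S, (1 + x i) - 1 - ∑ i ∈ S, x i| ≤ C * ε ^ 2 := by
  induction S using Finset.induction_on with
  | empty => exact ⟨0, le_rfl, by intros; simp⟩
  | insert a S ha ih =>
    obtain ⟨C, hC, h⟩ := ih
    refine ⟨C + (C * R + S.card), by positivity, fun x ε h0 hε hx => ?_⟩
    rw [Finset.prod_insert ha, Finset.sum_insert ha]
    have h1 := h x ε h0 hε hx
    set P := ∏ i ∈ S, (1 + x i)
    have h2 : |∑ i ∈ S, x i| ≤ S.card * ε := by
      calc |∑ i ∈ S, x i| ≤ ∑ i ∈ S, |x i| := Finset.abs_sum_le_sum_abs _ _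
        _ ≤ ∑ i ∈ S, ε := Finset.sum_le_sum fun i _ => hx i
        _ = _ := by simp
    set Q := ∑ i ∈ S, x i
    have h3 : |P - 1| ≤ (C * R + S.card) * ε := by
      calc |P - 1| = |(P - 1 - Q) + Q| := by ring_nf
        _ ≤ |P - 1 - Q| + |Q| := abs_add_le _ _
        _ ≤ C * ε ^ 2 + S.card * ε := add_le_add h1 h2
        _ ≤ C * (R * ε) + S.card * ε := by
          have : ε ^ 2 ≤ R * ε := by nlinarith
          gcongr
        _ = _ := by ring
    calc |(1 + x a) * P - 1 - (x a + Q)| = |(P - 1 - Q) + x a * (P - 1)| := by ring_nf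
      _ ≤ |P - 1 - Q| + |x a| * |P - 1| := by
        rw [← abs_mul]; exact abs_add_le _ _
      _ ≤ C * ε ^ 2 + ε * ((C * R + S.card) * ε) := by
        gcongr; exact hx a
      _ = _ := by ring

lemma det_aux (n : ℕ) (R : ℝ) (hR : 0 ≤ R) :
    ∃ C : ℝ, 0 ≤ C ∧ ∀ (X : Matrix (Fin n) (Fin n) ℝ) (ε : ℝ), 0 ≤ ε → ε ≤ R →
      (∀ i j, |X i j| ≤ ε) →
      |(1 + X).det - 1 - ∑ i, X i i| ≤ C * ε ^ 2 := by
  obtain ⟨C, hC, h⟩ := prod_aux R hR (Finset.univ : Finset (Fin n))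
  set N : ℝ := ((Finset.univ.erase (1 : Equiv.Perm (Fin n))).card : ℝ)
  refine ⟨C + N * (1 + R) ^ n, by positivity, fun X ε h0 hε hX => ?_⟩
  have h1 := h (fun i => X i i) ε h0 hε (fun i => hX i i)
  rw [Matrix.det_apply, ← Finset.add_sum_erase _ _ (Finset.mem_univ (1 : Equiv.Perm (Fin n)))]
  have key : ∀ σ ∈ Finset.univ.erase (1 : Equiv.Perm (Fin n)),
      |Equiv.Perm.sign σ • ∏ i, (1 + X) (σ i) i| ≤ (1 + R) ^ n * ε ^ 2 := by
    intro σ hσ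
    have hne : σ ≠ 1 := Finset.ne_of_mem_erase hσ
    have e1 : |Equiv.Perm.sign σ • ∏ i, (1 + X) (σ i) i| = ∏ i, |(1 + X) (σ i) i| := by
      rw [← Finset.abs_prod]
      rcases Int.units_eq_one_or (Equiv.Perm.sign σ) with h | h <;> simp [h]
    rw [e1]
    have hent : ∀ i j, |(1 + X) i j| ≤ 1 + R := by
      intro i j
      have hx := hX i j
      rw [Matrix.add_apply, Matrix.one_apply]
      refine (abs_add_le _ _).trans ?_
      split_ifs <;> simp <;> linarith
    have hcard := Equiv.Perm.one_lt_card_support_of_ne_one hne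
    obtain ⟨a, ha, b, hb, hab⟩ := Finset.one_lt_card.1 hcard
    rw [Equiv.Perm.mem_support] at ha hb
    have hoff : ∀ i, σ i ≠ i → |(1 + X) (σ i) i| ≤ ε := by
      intro i hi
      rw [Matrix.add_apply, Matrix.one_apply_ne hi, zero_add]; exact hX _ _
    rw [← Finset.mul_prod_erase _ _ (Finset.mem_univ a),
      ← Finset.mul_prod_erase _ _ (Finset.mem_erase.2 ⟨hab.symm, Finset.mem_univ b⟩)]
    have hrest : ∏ i ∈ (Finset.univ.erase a).erase b, |(1 + X) (σ i) i| ≤ (1 + R) ^ n := by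
      calc _ ≤ ∏ i ∈ (Finset.univ.erase a).erase b, (1 + R) :=
            Finset.prod_le_prod (fun _ _ => abs_nonneg _) (fun i _ => hent _ _)
        _ = (1 + R) ^ ((Finset.univ.erase a).erase b).card := by simp
        _ ≤ _ := by
          apply pow_le_pow_right₀ (by linarith)
          refine (Finset.card_le_univ _).trans (by simp)
    calc _ ≤ ε * (ε * (1 + R) ^ n) := by
          gcongr
          · exact hoff a ha
          · exact hoff b hb
      _ = _ := by ring
  have hsum : |∑ σ ∈ Finset.univ.erase (1 : Equiv.Perm (Fin n)),
      Equiv.Perm.sign σ • ∏ i, (1 + X) (σ i) i| ≤ N * ((1 + R) ^ n * ε ^ 2) := by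
    refine (Finset.abs_sum_le_sum_abs _ _).trans ?_
    refine (Finset.sum_le_sum key).trans ?_
    simp [N]
  set Q := ∑ σ ∈ Finset.univ.erase (1 : Equiv.Perm (Fin n)),
      Equiv.Perm.sign σ • ∏ i, (1 + X) (σ i) i
  have e2 : Equiv.Perm.sign (1 : Equiv.Perm (Fin n)) • ∏ i, (1 + X) ((1 : Equiv.Perm (Fin n)) i) i
      = ∏ i, (1 + X i i) := by simp
  rw [e2]
  calc _ = |(∏ i, (1 + X i i) - 1 - ∑ i, X i i) + Q| := by ring_nf
    _ ≤ _ := abs_add_le _ _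
    _ ≤ C * ε ^ 2 + N * ((1 + R) ^ n * ε ^ 2) := add_le_add h1 hsum
    _ = _ := by ring

lemma gram_aux {E : Type*} [NormedAddCommGroup E] [InnerProductSpace ℝ E]
    (n : ℕ) (R : ℝ) (hR : 0 ≤ R) :
    ∃ C : ℝ, 0 ≤ C ∧ ∀ (τ : Fin n → E) (A : E →L[ℝ] E) (η : ℝ), Orthonormal ℝ τ → 0 ≤ η → η ≤ R →
      ‖A - ContinuousLinearMap.id ℝ E‖ ≤ η →
      |√(Matrix.det (Matrix.of fun i j => ⟪A (τ i), A (τ j)⟫)) - 1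
        - ∑ i, ⟪τ i, (A - ContinuousLinearMap.id ℝ E) (τ i)⟫| ≤ C * η ^ 2 := by
  obtain ⟨C, hC, h⟩ := det_aux n ((2 + R) * R) (by positivity)
  refine ⟨((n + C * ((2 + R) * R)) * (2 + R)) ^ 2 / 2 + (C * (2 + R) ^ 2 + n) / 2, by positivity,
    fun τ A η hτ h0 hη hB => ?_⟩
  set B := A - ContinuousLinearMap.id ℝ E with hBdef
  have hA : ∀ x, A x = x + B x := by intro x; simp [hBdef]
  have hn : ∀ i, ‖τ i‖ = 1 := hτ.1
  have hBn : ∀ i, ‖B (τ i)‖ ≤ η := by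
    intro i
    have := B.le_opNorm (τ i)
    rw [hn, mul_one] at this
    exact this.trans hB
  set X : Matrix (Fin n) (Fin n) ℝ := Matrix.of fun i j =>
    ⟪τ i, B (τ j)⟫ + ⟪B (τ i), τ j⟫ + ⟪B (τ i), B (τ j)⟫ with hX
  have hG : (Matrix.of fun i j => ⟪A (τ i), A (τ j)⟫ : Matrix (Fin n) (Fin n) ℝ) = 1 + X := by
    ext i j
    have := orthonormal_iff_ite.1 hτ i j
    simp only [hX, Matrix.of_apply, Matrix.add_apply, Matrix.one_apply, hA, inner_add_left,
      inner_add_right, this]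
    ring
  have hdet : 0 ≤ (1 + X).det := by
    rw [← hG]
    exact (Matrix.posSemidef_gram ℝ (fun i => A (τ i))).det_nonneg
  rw [hG]
  have hε : ∀ i j, |X i j| ≤ (2 + R) * η := by
    intro i j
    have a1 : |⟪τ i, B (τ j)⟫| ≤ η := by
      refine (abs_real_inner_le_norm _ _).trans ?_
      rw [hn, one_mul]; exact hBn j
    have a2 : |⟪B (τ i), τ j⟫| ≤ η := by
      refine (abs_real_inner_le_norm _ _).trans ?_
      rw [hn, mul_one]; exact hBn i
    have a3 : |⟪B (τ i), B (τ j)⟫| ≤ R * η := by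
      refine (abs_real_inner_le_norm _ _).trans ?_
      exact mul_le_mul ((hBn i).trans hη) (hBn j) (norm_nonneg _) hR
    simp only [hX, Matrix.of_apply]
    have := abs_add_le (⟪τ i, B (τ j)⟫ + ⟪B (τ i), τ j⟫) ⟪B (τ i), B (τ j)⟫
    have := abs_add_le ⟪τ i, B (τ j)⟫ ⟪B (τ i), τ j⟫
    linarith
  have hd := h X ((2 + R) * η) (by positivity) (by gcongr) hε
  have hs := sqrt_aux ((1 + X).det - 1) (by linarith)
  rw [add_sub_cancel] at hs
  set d := (1 + X).det
  have htr : ∑ i, X i i = 2 * ∑ i, ⟪τ i, B (τ i)⟫ + ∑ i, ‖B (τ i)‖ ^ 2 := by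
    rw [Finset.mul_sum, ← Finset.sum_add_distrib]
    refine Finset.sum_congr rfl fun i _ => ?_
    simp only [hX, Matrix.of_apply]
    rw [real_inner_comm (τ i) (B (τ i)), real_inner_self_eq_norm_sq]; ring
  have hq0 : 0 ≤ ∑ i, ‖B (τ i)‖ ^ 2 := by positivity
  have hq1 : ∑ i, ‖B (τ i)‖ ^ 2 ≤ n * η ^ 2 := by
    calc _ ≤ ∑ i : Fin n, η ^ 2 := Finset.sum_le_sum fun i _ => by gcongr; exact hBn i
      _ = _ := by simp
  have ht : |∑ i, X i i| ≤ n * ((2 + R) * η) := by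
    calc |∑ i, X i i| ≤ ∑ i, |X i i| := Finset.abs_sum_le_sum_abs _ _
      _ ≤ ∑ i : Fin n, ((2 + R) * η) := Finset.sum_le_sum fun i _ => hε i i
      _ = _ := by simp
  have hx : |d - 1| ≤ ((n + C * ((2 + R) * R)) * (2 + R)) * η := by
    calc |d - 1| = |(d - 1 - ∑ i, X i i) + ∑ i, X i i| := by ring_nf
      _ ≤ _ := abs_add_le _ _
      _ ≤ C * ((2 + R) * η) ^ 2 + n * ((2 + R) * η) := add_le_add hd ht
      _ = C * ((2 + R) * η) * ((2 + R) * η) + n * ((2 + R) * η) := by ring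
      _ ≤ C * ((2 + R) * R) * ((2 + R) * η) + n * ((2 + R) * η) := by gcongr
      _ = _ := by ring
  have hx2 : (d - 1) ^ 2 ≤ (((n + C * ((2 + R) * R)) * (2 + R)) * η) ^ 2 := by
    rw [← sq_abs]; gcongr
  rw [htr] at hd
  rw [mul_pow] at hx2
  rw [abs_le] at hs hd ⊢
  constructor <;> nlinarith

lemma flow_aux {E : Type*} [NormedAddCommGroup E] [NormedSpace ℝ E]
    (K C₀ T : ℝ) (hK : 0 ≤ K) (hC₀ : 0 ≤ C₀) (hT : 0 < T) (Y : E → E) (Φ : ℝ → E → E)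
    (hY : ContDiff ℝ (⊤ : ℕ∞) Y) (hYK : ∀ x, ‖Y x‖ ≤ K)
    (h1 : ∀ x, ‖fderiv ℝ Y x‖ ≤ C₀ * ((1 + ‖x‖) ^ 2)⁻¹)
    (h2 : ∀ x, ‖fderiv ℝ (fderiv ℝ Y) x‖ ≤ C₀ * ((1 + ‖x‖) ^ 2)⁻¹)
    (hΦ : ∀ t ∈ Set.Icc (0 : ℝ) T, ContDiff ℝ (⊤ : ℕ∞) (Φ t))
    (hΦ0 : ∀ p, Φ 0 p = p)
    (hode : ∀ p, ∀ t ∈ Set.Icc (0 : ℝ) T,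
          HasDerivWithinAt (fun s => Φ s p) (Y (Φ t p)) (Set.Icc (0 : ℝ) T) t)
    (t : ℝ) (ht : t ∈ Set.Icc (0 : ℝ) T) (p : E) :
    ‖fderiv ℝ (Φ t) p - ContinuousLinearMap.id ℝ E - t • fderiv ℝ Y p‖ ≤
      ((C₀ * K + C₀ ^ 2) * (K * T + 2) ^ 2 * Real.exp (C₀ * T)) * t ^ 2 * ((1 + ‖p‖) ^ 2)⁻¹ := by
  set w := ((1 + ‖p‖) ^ 2)⁻¹ with hw
  set L := (C₀ * K + C₀ ^ 2) * (K * T + 2) ^ 2 * Real.exp (C₀ * T) with hL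
  have hw0 : 0 ≤ w := by positivity
  have hL0 : 0 ≤ L := by positivity
  have ht0 := ht.1
  have hYd : Differentiable ℝ Y := hY.differentiable (by simp)
  have hY' : ContDiff ℝ 1 (fderiv ℝ Y) := hY.fderiv_right (by
    rw [one_add_one_eq_two]; exact WithTop.coe_le_coe.2 le_top)
  have hYd' : Differentiable ℝ (fderiv ℝ Y) := hY'.differentiable (by simp)
  have hw1 : ∀ x : E, ((1 + ‖x‖) ^ 2)⁻¹ ≤ 1 := by
    intro x
    apply inv_le_one_of_one_le₀
    nlinarith [norm_nonneg x]
  have hb1 : ∀ x, ‖fderiv ℝ Y x‖ ≤ C₀ := fun x =>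
    (h1 x).trans (mul_le_of_le_one_right hC₀ (hw1 x))
  have hLip : LipschitzWith C₀.toNNReal Y := by
    apply lipschitzWith_of_nnnorm_fderiv_le hYd
    intro x
    rw [← NNReal.coe_le_coe, coe_nnnorm, Real.coe_toNNReal _ hC₀]
    exact hb1 x
  -- Gronwall
  have hgron : ∀ x y, ∀ s ∈ Set.Icc (0 : ℝ) T,
      ‖Φ s x - Φ s y‖ ≤ Real.exp (C₀ * T) * ‖x - y‖ := by
    intro x y s hs
    have hc : ∀ x, ContinuousOn (fun s => Φ s x) (Set.Icc 0 T) := fun x s hs =>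
      (hode x s hs).continuousWithinAt
    have hd : ∀ x, ∀ t ∈ Set.Ico (0 : ℝ) T,
        HasDerivWithinAt (fun s => Φ s x) (Y (Φ t x)) (Set.Ici t) t := fun x t ht =>
      (hode x t (Set.Ico_subset_Icc_self ht)).mono_of_mem_nhdsWithin (Icc_mem_nhdsGE_of_mem ht)
    have := dist_le_of_trajectories_ODE (v := fun _ => Y) (fun _ => hLip) (hc x) (hd x) (hc y) (hd y)
      (le_refl _) s hs
    simp only [hΦ0, dist_eq_norm, Real.coe_toNNReal _ hC₀, sub_zero] at this
    refine this.trans ?_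
    rw [mul_comm]
    gcongr
    exact hs.2
  have hmove : ∀ x, ∀ s ∈ Set.Icc (0 : ℝ) T, ‖Φ s x - x‖ ≤ K * T := by
    intro x s hs
    have := Convex.norm_image_sub_le_of_norm_hasDerivWithin_le (hode x)
      (fun s _ => hYK (Φ s x)) (convex_Icc 0 T) (Set.left_mem_Icc.2 hT.le) hs
    rw [hΦ0, sub_zero, Real.norm_of_nonneg hs.1] at this
    exact this.trans (by gcongr; exact hs.2)
  set W : E → E := fun x => fderiv ℝ Y x (Y x) with hWdef
  have hWd : ∀ x, HasFDerivAt W ((fderiv ℝ Y x).comp (fderiv ℝ Y x)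
      + (fderiv ℝ (fderiv ℝ Y) x).flip (Y x)) x := fun x =>
    (hYd' x).hasFDerivAt.clm_apply (hYd x).hasFDerivAt
  set ρ := K * T + 1 with hρ
  have hWlip : ∀ x ∈ closedBall p ρ, ∀ y ∈ closedBall p ρ,
      ‖W y - W x‖ ≤ ((C₀ * K + C₀ ^ 2) * (K * T + 2) ^ 2 * w) * ‖y - x‖ := by
    intro x hx y hy
    refine Convex.norm_image_sub_le_of_norm_hasFDerivWithin_le
      (fun z _ => (hWd z).hasFDerivWithinAt) ?_ (convex_closedBall p ρ) hx hy
    intro z hz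
    rw [mem_closedBall, dist_eq_norm] at hz
    have hpz : 1 + ‖p‖ ≤ (K * T + 2) * (1 + ‖z‖) := by
      have : ‖p‖ ≤ ‖z‖ + ‖z - p‖ := by
        have := norm_sub_le z (z - p)
        simpa using this
      have := mul_nonneg (show 0 ≤ K * T + 1 by positivity) (norm_nonneg z)
      nlinarith
    have hwz : ((1 + ‖z‖) ^ 2)⁻¹ ≤ (K * T + 2) ^ 2 * w := by
      rw [hw, ← div_eq_mul_inv, inv_eq_one_div, div_le_div_iff₀ (by positivity) (by positivity),
        one_mul, ← mul_pow]
      gcongr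
    have b1 := h1 z
    have b2 := h2 z
    have b3 := hYK z
    have b4 := hb1 z
    calc _ ≤ ‖fderiv ℝ Y z‖ * ‖fderiv ℝ Y z‖ + ‖fderiv ℝ (fderiv ℝ Y) z‖ * ‖Y z‖ := by
          refine (norm_add_le _ _).trans (add_le_add (ContinuousLinearMap.opNorm_comp_le _ _) ?_)
          refine (ContinuousLinearMap.le_opNorm _ _).trans ?_
          rw [ContinuousLinearMap.opNorm_flip]
      _ ≤ (C₀ * ((1 + ‖z‖) ^ 2)⁻¹) * C₀ + (C₀ * ((1 + ‖z‖) ^ 2)⁻¹) * K := by gcongr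
      _ = (C₀ * K + C₀ ^ 2) * ((1 + ‖z‖) ^ 2)⁻¹ := by ring
      _ ≤ (C₀ * K + C₀ ^ 2) * ((K * T + 2) ^ 2 * w) := by gcongr
      _ = _ := by ring
  have hball : ∀ q, ‖q - p‖ ≤ 1 → ∀ s ∈ Set.Icc (0 : ℝ) T, Φ s q ∈ closedBall p ρ := by
    intro q hq s hs
    rw [mem_closedBall, dist_eq_norm]
    have := norm_add_le (Φ s q - q) (q - p)
    rw [sub_add_sub_cancel] at this
    have := hmove q s hs
    linarith
  have hsub : Set.Icc 0 t ⊆ Set.Icc 0 T := Set.Icc_subset_Icc_right ht.2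
  have hYode : ∀ q, ∀ s ∈ Set.Icc (0 : ℝ) T,
      HasDerivWithinAt (fun s => Y (Φ s q)) (W (Φ s q)) (Set.Icc (0 : ℝ) T) s := fun q s hs =>
    (hYd (Φ s q)).hasFDerivAt.comp_hasDerivWithinAt s (hode q s hs)
  have hG : ∀ q, ‖q - p‖ ≤ 1 →
      ‖(Φ t q - q - t • Y q) - (Φ t p - p - t • Y p)‖ ≤ (L * t ^ 2 * w) * ‖q - p‖ := by
    intro q hq
    have hZ : ∀ s ∈ Set.Icc 0 t, ‖(Y (Φ s q) - Y (Φ s p)) - (Y q - Y p)‖ ≤ (L * w * ‖q - p‖) * t := by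
      intro s hs
      have := Convex.norm_image_sub_le_of_norm_hasDerivWithin_le
        (f := fun s => Y (Φ s q) - Y (Φ s p)) (f' := fun s => W (Φ s q) - W (Φ s p))
        (s := Set.Icc 0 T) (C := L * w * ‖q - p‖)
        (fun s hs => (hYode q s hs).sub (hYode p s hs)) ?_ (convex_Icc 0 T)
        (Set.left_mem_Icc.2 hT.le) (hsub hs)
      · simp only [hΦ0] at this
        refine this.trans ?_
        rw [sub_zero, Real.norm_of_nonneg hs.1]
        gcongr
        exact hs.2
      · intro s hs
        refine (hWlip _ (hball p (by simp) s hs) _ (hball q hq s hs)).trans ?_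
        have := hgron q p s hs
        calc _ ≤ ((C₀ * K + C₀ ^ 2) * (K * T + 2) ^ 2 * w) * (Real.exp (C₀ * T) * ‖q - p‖) := by
              gcongr
          _ = _ := by rw [hL]; ring
    have := Convex.norm_image_sub_le_of_norm_hasDerivWithin_le
        (f := fun s => (Φ s q - Φ s p) - s • (Y q - Y p))
        (f' := fun s => (Y (Φ s q) - Y (Φ s p)) - (1 : ℝ) • (Y q - Y p))
        (s := Set.Icc 0 t) (C := (L * w * ‖q - p‖) * t)
        (fun s hs => (((hode q s (hsub hs)).sub (hode p s (hsub hs))).mono hsub).sub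
          ((hasDerivWithinAt_id s _).smul_const (Y q - Y p)))
        (fun s hs => by rw [one_smul]; exact hZ s hs) (convex_Icc 0 t)
        (Set.left_mem_Icc.2 ht0) (Set.right_mem_Icc.2 ht0)
    simp only [hΦ0, zero_smul, sub_zero, Real.norm_of_nonneg ht0] at this
    calc _ = ‖Φ t q - Φ t p - t • (Y q - Y p) - (q - p)‖ := by
          congr 1; rw [smul_sub]; abel
      _ ≤ _ := this
      _ = _ := by ring
  have hder : HasFDerivAt (fun q => Φ t q - q - t • Y q)
      (fderiv ℝ (Φ t) p - ContinuousLinearMap.id ℝ E - t • fderiv ℝ Y p) p :=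
    ((((hΦ t ht).differentiable (by simp)) p).hasFDerivAt.sub (hasFDerivAt_id p)).sub
      ((hYd p).hasFDerivAt.const_smul t)
  refine hder.le_of_lip' (by positivity) ?_
  filter_upwards [closedBall_mem_nhds p one_pos] with q hq
  exact hG q (by rwa [mem_closedBall, dist_eq_norm] at hq)

set_option maxHeartbeats 1000000 in
/-- first-order expansion of the spherical Jacobian `JΦ` of the flow;
cf. Corollary A.4 in Bernstein–Wang. The function `J(t,p,v) = √det(b_{ij})`, with
`b_{ij} = (∇_pΦ τ_i)·(∇_pΦ τ_j)` for an orthonormal basis `(τ_i)` of `v^⊥`, satisfies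
`J(0,p,v) = 1` and `|J(t,p,v) − 1 − t(div Y(p) − (∇Y(p)v)·v)| ≤ C₃ t² (1+|p|)⁻²` with
`C₃` depending only on `n`, `ℛ₁`, `M₀`, `C₀` and `T`. -/
theorem flow_jacobian_taylor
    (n : ℕ) (hn : 2 ≤ n) (R₁ M₀ C₀ T : ℝ)
    (hR₁ : 1 < R₁) (hM₀ : 0 < M₀) (hC₀ : 0 < C₀) (hT : 0 < T) :
    ∃ C₃ : ℝ, 0 < C₃ ∧
      ∀ (χ : Euc n → ℝ) (α : ℝ) (Y : Euc n → Euc n) (Φ : ℝ → Euc n → Euc n)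
        (J : ℝ → Euc n → Euc n → ℝ),
        ContDiff ℝ (⊤ : ℕ∞) χ → (∀ p, χ p ∈ Set.Icc (0 : ℝ) 1) →
        (∀ p : Euc n, ‖p‖ ≤ R₁ → χ p = 0) → (∀ p : Euc n, R₁ + 1 ≤ ‖p‖ → χ p = 1) →
        |α| ≤ M₀ → ContDiff ℝ (⊤ : ℕ∞) Y →
        (∀ p : Euc n, (1 + ‖p‖) ^ 3 * ‖Y p - (α * χ p * (‖p‖ ^ 2)⁻¹) • p‖ ≤ C₀) →
        (∀ p : Euc n, (1 + ‖p‖) ^ 2 * (‖iteratedFDeriv ℝ 1 Y p‖ +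
          ‖iteratedFDeriv ℝ 2 Y p‖ + ‖iteratedFDeriv ℝ 3 Y p‖) ≤ C₀) →
        ContDiffOn ℝ (⊤ : ℕ∞) (fun q : ℝ × Euc n => Φ q.1 q.2)
          (Set.Icc (0 : ℝ) T ×ˢ Set.univ) →
        (∀ t ∈ Set.Icc (0 : ℝ) T, ContDiff ℝ (⊤ : ℕ∞) (Φ t)) →
        (∀ p, Φ 0 p = p) →
        (∀ p, ∀ t ∈ Set.Icc (0 : ℝ) T,
          HasDerivWithinAt (fun s => Φ s p) (Y (Φ t p)) (Set.Icc (0 : ℝ) T) t) →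
        (∀ (t : ℝ) (p v : Euc n), v ∈ Sph n →
          ∀ τ : Fin n → Euc n, Orthonormal ℝ τ → (∀ i, ⟪τ i, v⟫ = 0) →
            J t p v = Real.sqrt (Matrix.det (Matrix.of fun i j =>
              ⟪(fderiv ℝ (Φ t) p) (τ i), (fderiv ℝ (Φ t) p) (τ j)⟫))) →
        (∀ (p v : Euc n), v ∈ Sph n → J 0 p v = 1) ∧
        ∀ t ∈ Set.Icc (0 : ℝ) T, ∀ (p v : Euc n), v ∈ Sph n →
          |J t p v - 1 - t * (LinearMap.trace ℝ (Euc n) (fderiv ℝ Y p).toLinearMap -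
              ⟪(fderiv ℝ Y p) v, v⟫)| ≤ C₃ * t ^ 2 * ((1 + ‖p‖) ^ 2)⁻¹ := by
  set K := C₀ + M₀ with hKdef
  set L := (C₀ * K + C₀ ^ 2) * (K * T + 2) ^ 2 * Real.exp (C₀ * T) with hL
  have hK : 0 < K := by positivity
  have hL0 : 0 ≤ L := by positivity
  obtain ⟨C, hC, hgram⟩ := gram_aux (E := Euc n) n ((C₀ + L * T) * T) (by positivity)
  refine ⟨C * (C₀ + L * T) ^ 2 + n * L + 1, by positivity, ?_⟩
  intro χ α Y Φ J hχ hχ01 hχ0 hχ1 hα hY hYa hYd hΦc hΦ hΦ0 hode hJ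
  have hYK : ∀ x, ‖Y x‖ ≤ K := by
    intro x
    have h1 := hYa x
    have h2 : ‖Y x - (α * χ x * (‖x‖ ^ 2)⁻¹) • x‖ ≤ C₀ := by
      refine le_trans ?_ h1
      apply le_mul_of_one_le_left (norm_nonneg _)
      exact one_le_pow₀ (by linarith [norm_nonneg x])
    have h3 : ‖(α * χ x * (‖x‖ ^ 2)⁻¹) • x‖ ≤ M₀ := by
      rcases le_or_gt ‖x‖ R₁ with h | h
      · rw [hχ0 x h]; simpa using hM₀.le
      · have hx1 : 1 < ‖x‖ := hR₁.trans h
        have hc := hχ01 x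
        rw [norm_smul, norm_mul, norm_mul, Real.norm_eq_abs, Real.norm_of_nonneg hc.1,
          Real.norm_of_nonneg (by positivity)]
        have e : (‖x‖ ^ 2)⁻¹ * ‖x‖ ≤ 1 := by
          rw [inv_mul_le_iff₀ (by positivity)]; nlinarith
        calc |α| * χ x * (‖x‖ ^ 2)⁻¹ * ‖x‖ = |α| * χ x * ((‖x‖ ^ 2)⁻¹ * ‖x‖) := by ring
          _ ≤ M₀ * 1 * 1 := by
            have := hc.1
            have := hc.2
            gcongr
          _ = M₀ := by ring
    have h4 := norm_add_le (Y x - (α * χ x * (‖x‖ ^ 2)⁻¹) • x) ((α * χ x * (‖x‖ ^ 2)⁻¹) • x)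
    rw [sub_add_cancel] at h4
    linarith
  have h1 : ∀ x, ‖fderiv ℝ Y x‖ ≤ C₀ * ((1 + ‖x‖) ^ 2)⁻¹ := by
    intro x
    have := hYd x
    rw [← div_eq_mul_inv, le_div_iff₀ (by positivity), ← norm_iteratedFDeriv_one, mul_comm]
    refine le_trans ?_ this
    gcongr
    linarith [norm_nonneg (iteratedFDeriv ℝ 2 Y x), norm_nonneg (iteratedFDeriv ℝ 3 Y x)]
  have h2 : ∀ x, ‖fderiv ℝ (fderiv ℝ Y) x‖ ≤ C₀ * ((1 + ‖x‖) ^ 2)⁻¹ := by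
    intro x
    have := hYd x
    rw [← div_eq_mul_inv, le_div_iff₀ (by positivity), ← norm_iteratedFDeriv_one,
      norm_iteratedFDeriv_fderiv, mul_comm]
    refine le_trans ?_ this
    gcongr
    linarith [norm_nonneg (iteratedFDeriv ℝ 1 Y x), norm_nonneg (iteratedFDeriv ℝ 3 Y x)]
  have main : ∀ t ∈ Set.Icc (0 : ℝ) T, ∀ (p v : Euc n), v ∈ Sph n →
          |J t p v - 1 - t * (LinearMap.trace ℝ (Euc n) (fderiv ℝ Y p).toLinearMap -
              ⟪(fderiv ℝ Y p) v, v⟫)| ≤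
            (C * (C₀ + L * T) ^ 2 + n * L + 1) * t ^ 2 * ((1 + ‖p‖) ^ 2)⁻¹ := by
    intro t ht p v hv
    have hE := flow_aux K C₀ T hK.le hC₀.le hT Y Φ hY hYK h1 h2 hΦ hΦ0 hode t ht p
    rw [← hL] at hE
    have hD := h1 p
    have hw0 : 0 ≤ ((1 + ‖p‖) ^ 2)⁻¹ := by positivity
    have hw1 : ((1 + ‖p‖) ^ 2)⁻¹ ≤ 1 := by
      apply inv_le_one_of_one_le₀
      exact one_le_pow₀ (by linarith [norm_nonneg p])
    set w := ((1 + ‖p‖) ^ 2)⁻¹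
    obtain ⟨ht0, htT⟩ := ht
    have hvn : ‖v‖ = 1 := by simpa [Sph] using hv
    obtain ⟨b, hb⟩ := Orthonormal.exists_orthonormalBasis_extension_of_card_eq
      (𝕜 := ℝ) (E := Euc n) (ι := Fin (n + 1)) (by simp) (v := fun _ => v) (s := {0}) (by
        refine ⟨fun i => by simpa using hvn, fun i j hij => ?_⟩
        exact absurd (Subsingleton.elim i j) hij)
    have hb0 : b 0 = v := hb 0 rfl
    set τ : Fin n → Euc n := fun i => b i.succ with hτdef
    have hτ : Orthonormal ℝ τ := b.orthonormal.comp _ (Fin.succ_injective n)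
    have hτv : ∀ i, ⟪τ i, v⟫ = 0 := by
      intro i
      rw [← hb0]
      exact b.orthonormal.2 (Fin.succ_ne_zero i)
    rw [hJ t p v hv τ hτ hτv]
    have htr : LinearMap.trace ℝ (Euc n) (fderiv ℝ Y p).toLinearMap - ⟪(fderiv ℝ Y p) v, v⟫
        = ∑ i, ⟪τ i, fderiv ℝ Y p (τ i)⟫ := by
      rw [LinearMap.trace_eq_sum_inner _ b, Fin.sum_univ_succ, hb0, real_inner_comm v]
      simp [hτdef]
    rw [htr]
    set A := fderiv ℝ (Φ t) p
    set D := fderiv ℝ Y p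
    set F := A - ContinuousLinearMap.id ℝ (Euc n) - t • D with hF
    have hB : ‖A - ContinuousLinearMap.id ℝ (Euc n)‖ ≤ (C₀ + L * T) * t * w := by
      have e : A - ContinuousLinearMap.id ℝ (Euc n) = t • D + F := by rw [hF]; abel
      rw [e]
      calc ‖t • D + F‖ ≤ ‖t • D‖ + ‖F‖ := norm_add_le _ _
        _ ≤ t * (C₀ * w) + L * (t * t) * w := by
          rw [norm_smul, Real.norm_of_nonneg ht0]
          refine add_le_add (by gcongr) (by rwa [← sq])
        _ ≤ t * (C₀ * w) + L * (T * t) * w := by gcongr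
        _ = _ := by ring
    have hg := hgram τ A ((C₀ + L * T) * t * w) hτ (by positivity) (by
      calc (C₀ + L * T) * t * w ≤ (C₀ + L * T) * T * 1 := by gcongr
        _ = _ := by ring) hB
    have hs : ∑ i, ⟪τ i, (A - ContinuousLinearMap.id ℝ (Euc n)) (τ i)⟫
        = t * ∑ i, ⟪τ i, D (τ i)⟫ + ∑ i, ⟪τ i, F (τ i)⟫ := by
      rw [Finset.mul_sum, ← Finset.sum_add_distrib]
      refine Finset.sum_congr rfl fun i _ => ?_
      rw [← real_inner_smul_right, ← inner_add_right]
      congr 1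
      simp [hF]
    have hFs : |∑ i, ⟪τ i, F (τ i)⟫| ≤ n * (L * t ^ 2 * w) := by
      calc _ ≤ ∑ i, |⟪τ i, F (τ i)⟫| := Finset.abs_sum_le_sum_abs _ _
        _ ≤ ∑ i : Fin n, (L * t ^ 2 * w) := by
          refine Finset.sum_le_sum fun i _ => ?_
          refine (abs_real_inner_le_norm _ _).trans ?_
          have := F.le_opNorm (τ i)
          rw [hτ.1 i, mul_one] at this
          rw [hτ.1 i, one_mul]
          exact this.trans hE
        _ = _ := by simp
    rw [hs] at hg
    have hw2 : C * ((C₀ + L * T) * t * w) ^ 2 ≤ C * (C₀ + L * T) ^ 2 * t ^ 2 * w := by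
      calc _ = C * (C₀ + L * T) ^ 2 * t ^ 2 * (w * w) := by ring
        _ ≤ C * (C₀ + L * T) ^ 2 * t ^ 2 * (w * 1) := by gcongr
        _ = _ := by ring
    have hpos : 0 ≤ t ^ 2 * w := by positivity
    have hfin : (C * (C₀ + L * T) ^ 2 + n * L + 1) * t ^ 2 * w
        = C * (C₀ + L * T) ^ 2 * t ^ 2 * w + n * (L * t ^ 2 * w) + t ^ 2 * w := by ring
    rw [hfin]
    rw [abs_le] at hg hFs ⊢
    obtain ⟨hg1, hg2⟩ := hg
    obtain ⟨hf1, hf2⟩ := hFs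
    constructor <;> linarith only [hg1, hg2, hf1, hf2, hw2, hpos]
  refine ⟨fun p v hv => ?_, main⟩
  have := main 0 ⟨le_rfl, hT.le⟩ p v hv
  simp only [zero_mul, sub_zero, ne_eq, OfNat.ofNat_ne_zero, not_false_eq_true, zero_pow,
    mul_zero] at this
  linarith [abs_nonpos_iff.1 this]
end
end

section
/- Let n ≥ 2 and let χ, α, Y, M₀, C̃₀, ℛ₁, T, the flow Φ and the Jacobian JΦ(t,p,v) be as in the context. Set c(α,t) = 1 + αt/2 + ((αt)²/4)∫₀¹ e^{αtρ/2}(1−ρ)dρ (which equals e^{αt/2}). Then there is a constant C > 0, depending only on n, ℛ₁, M₀, C̃₀ and T, such that for all t ∈ [0,T], p ∈ ℝ^{n+1} and v ∈ S^n: | JΦ(t,p,v) · e^{(|Φ(t,p)|² − |p|²)/4} − c(α,t) | ≤ C(1+|p|)^{-1}. -/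
noncomputable section

open Set Metric Real Filter
open scoped RealInnerProductSpace

lemma aux_exp (x : ℝ) : |rexp x - 1| ≤ |x| * rexp |x| := by
  have h1 := Real.add_one_le_exp x
  have h2 := Real.add_one_le_exp (-x)
  rcases le_or_gt 0 x with hx | hx
  · have h0 : 0 ≤ rexp x - 1 := by linarith
    rw [abs_of_nonneg hx, abs_of_nonneg h0]
    have h3 : rexp x * rexp (-x) = 1 := by rw [← Real.exp_add]; simp
    nlinarith [Real.exp_pos x]
  · have h0 : rexp x - 1 ≤ 0 := by
      have := Real.exp_le_one_iff.2 hx.le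
      linarith
    rw [abs_of_neg hx, abs_of_nonpos h0]
    nlinarith

lemma aux_int (x : ℝ) : 1 + x / 2 + (x ^ 2 / 4) *
    ∫ ρ in (0 : ℝ)..1, Real.exp (x * ρ / 2) * (1 - ρ) = rexp (x / 2) := by
  have h : ∫ ρ in (0 : ℝ)..1, (x ^ 2 / 4) * (Real.exp (x * ρ / 2) * (1 - ρ)) =
      (x / 2 * (1 - 1) * rexp (x * 1 / 2) + rexp (x * 1 / 2)) -
      (x / 2 * (1 - 0) * rexp (x * 0 / 2) + rexp (x * 0 / 2)) := by
    apply intervalIntegral.integral_eq_sub_of_hasDerivAt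
      (f := fun ρ => x / 2 * (1 - ρ) * rexp (x * ρ / 2) + rexp (x * ρ / 2))
    · intro ρ _
      have he : HasDerivAt (fun ρ : ℝ => rexp (x * ρ / 2)) (rexp (x * ρ / 2) * (x / 2)) ρ := by
        have := (((hasDerivAt_id ρ).const_mul x).div_const 2).exp
        simpa using this
      have hl : HasDerivAt (fun ρ : ℝ => x / 2 * (1 - ρ)) (x / 2 * (-1)) ρ :=
        ((hasDerivAt_id ρ).const_sub 1).const_mul (x / 2)
      exact ((hl.mul he).add he).congr_deriv (by ring)
    · apply Continuous.intervalIntegrable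
      fun_prop
  rw [intervalIntegral.integral_const_mul] at h
  rw [h]
  simp
  ring

lemma aux_sqrt (x : ℝ) : |√x - 1| ≤ |x - 1| := by
  rcases le_or_gt 0 x with hx | hx
  · have h : x - 1 = (√x - 1) * (√x + 1) := by
      nlinarith [Real.mul_self_sqrt hx]
    rw [h, abs_mul]
    have : (1 : ℝ) ≤ |√x + 1| := by
      rw [abs_of_nonneg (by positivity)]
      linarith [Real.sqrt_nonneg x]
    nlinarith [abs_nonneg (√x - 1)]
  · rw [Real.sqrt_eq_zero_of_nonpos hx.le, abs_of_neg (by linarith : x - 1 < 0)]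
    norm_num
    linarith

lemma aux_prod {ι : Type*} (s : Finset ι) (a b : ι → ℝ) (M η : ℝ) (hM : 0 ≤ M) (hη : 0 ≤ η)
    (ha : ∀ i, |a i| ≤ 1 + M) (hb : ∀ i, |b i| ≤ 1) (hab : ∀ i, |a i - b i| ≤ η) :
    |∏ i ∈ s, a i - ∏ i ∈ s, b i| ≤ s.card * (1 + M) ^ s.card * η := by
  classical
  induction s using Finset.induction_on with
  | empty => simp
  | insert i s hi ih =>
    rw [Finset.prod_insert hi, Finset.prod_insert hi, Finset.card_insert_of_notMem hi]
    have e : a i * ∏ i ∈ s, a i - b i * ∏ i ∈ s, b i =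
      a i * (∏ i ∈ s, a i - ∏ i ∈ s, b i) + (a i - b i) * ∏ i ∈ s, b i := by ring
    have hp : |∏ i ∈ s, b i| ≤ 1 := by
      rw [Finset.abs_prod]
      exact Finset.prod_le_one (fun _ _ => abs_nonneg _) (fun i _ => hb i)
    have h1 : |a i * (∏ i ∈ s, a i - ∏ i ∈ s, b i)| ≤
        (1 + M) * (s.card * (1 + M) ^ s.card * η) := by
      rw [abs_mul]
      exact mul_le_mul (ha i) ih (abs_nonneg _) (by linarith)
    have h2 : |(a i - b i) * ∏ i ∈ s, b i| ≤ η * 1 := by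
      rw [abs_mul]
      exact mul_le_mul (hab i) hp (abs_nonneg _) hη
    have h3 : (1 : ℝ) ≤ (1 + M) ^ (s.card + 1) := one_le_pow₀ (by linarith)
    rw [e]
    refine (abs_add_le _ _).trans ?_
    have h4 : η * 1 ≤ η * (1 + M) ^ (s.card + 1) := mul_le_mul_of_nonneg_left h3 hη
    push_cast
    calc _ ≤ (1 + M) * (s.card * (1 + M) ^ s.card * η) + η * (1 + M) ^ (s.card + 1) := by linarith
      _ = _ := by ring

lemma aux_det (n : ℕ) (M : ℝ) (hM : 0 ≤ M) : ∃ C : ℝ, 0 ≤ C ∧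
    ∀ (A : Matrix (Fin n) (Fin n) ℝ) (η : ℝ), 0 ≤ η → η ≤ M →
      (∀ i j, |A i j - (1 : Matrix (Fin n) (Fin n) ℝ) i j| ≤ η) → |A.det - 1| ≤ C * η := by
  refine ⟨(Fintype.card (Equiv.Perm (Fin n))) * (n * (1 + M) ^ n), by positivity, ?_⟩
  intro A η h0 hηM hA
  have h1 : ∀ i j, |(1 : Matrix (Fin n) (Fin n) ℝ) i j| ≤ 1 := by
    intro i j
    rw [Matrix.one_apply]
    split_ifs <;> simp
  have h2 : ∀ i j, |A i j| ≤ 1 + M := by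
    intro i j
    have e : A i j = (1 : Matrix (Fin n) (Fin n) ℝ) i j +
      (A i j - (1 : Matrix (Fin n) (Fin n) ℝ) i j) := by ring
    rw [e]
    exact (abs_add_le _ _).trans (add_le_add (h1 i j) ((hA i j).trans hηM))
  have hdd : A.det - 1 = A.det - (1 : Matrix (Fin n) (Fin n) ℝ).det := by rw [Matrix.det_one]
  rw [hdd, Matrix.det_apply', Matrix.det_apply', ← Finset.sum_sub_distrib]
  refine (Finset.abs_sum_le_sum_abs _ _).trans ?_
  have hb : ∀ σ ∈ (Finset.univ : Finset (Equiv.Perm (Fin n))),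
      |((Equiv.Perm.sign σ : ℤ) : ℝ) * ∏ i, A (σ i) i - ((Equiv.Perm.sign σ : ℤ) : ℝ) *
        ∏ i, (1 : Matrix (Fin n) (Fin n) ℝ) (σ i) i| ≤ n * (1 + M) ^ n * η := by
    intro σ _
    rw [← mul_sub, abs_mul]
    have hs : |((Equiv.Perm.sign σ : ℤ) : ℝ)| = 1 := by
      rcases Int.units_eq_one_or (Equiv.Perm.sign σ) with h | h <;> simp [h]
    rw [hs, one_mul]
    have := aux_prod Finset.univ (fun i => A (σ i) i)
      (fun i => (1 : Matrix (Fin n) (Fin n) ℝ) (σ i) i) M η hM h0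
      (fun i => h2 _ _) (fun i => h1 _ _) (fun i => hA _ _)
    simpa using this
  refine (Finset.sum_le_card_nsmul _ _ _ hb).trans ?_
  rw [nsmul_eq_mul, Finset.card_univ, ← mul_assoc]

section gen
variable {E : Type*} [NormedAddCommGroup E] [InnerProductSpace ℝ E]

lemma aux_Y (R₁ M₀ C₀ α c : ℝ) (hR₁ : 1 < R₁) (hα : |α| ≤ M₀) (p y : E)
    (hc : c ∈ Set.Icc (0 : ℝ) 1) (hc0 : ‖p‖ ≤ R₁ → c = 0) (hc1 : R₁ + 1 ≤ ‖p‖ → c = 1)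
    (h : (1 + ‖p‖) ^ 3 * ‖y - (α * c * (‖p‖ ^ 2)⁻¹) • p‖ ≤ C₀) :
    (1 + ‖p‖) * ‖y‖ ≤ C₀ + 2 * M₀ ∧ (1 + ‖p‖) * |⟪p, y⟫ - α| ≤ C₀ + M₀ * (R₁ + 2) := by
  obtain ⟨hc2, hc3⟩ := hc
  set z := y - (α * c * (‖p‖ ^ 2)⁻¹) • p with hz
  have hy : y = z + (α * c * (‖p‖ ^ 2)⁻¹) • p := by rw [hz]; abel
  have hp := norm_nonneg p
  have hzn := norm_nonneg z
  have hM : 0 ≤ M₀ := (abs_nonneg _).trans hα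
  have hz1 : (1 + ‖p‖) * ‖z‖ ≤ C₀ := by
    refine le_trans (mul_le_mul_of_nonneg_right ?_ hzn) h
    nlinarith [mul_nonneg hp hp, mul_nonneg (mul_nonneg hp hp) hp]
  have hz2 : (1 + ‖p‖) * (‖p‖ * ‖z‖) ≤ C₀ := by
    rw [← mul_assoc]
    refine le_trans (mul_le_mul_of_nonneg_right ?_ hzn) h
    nlinarith [mul_nonneg hp hp, mul_nonneg (mul_nonneg hp hp) hp]
  have hin : |⟪p, z⟫| ≤ ‖p‖ * ‖z‖ := abs_real_inner_le_norm p z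
  have hα' : |α * c| ≤ M₀ := by
    rw [abs_mul, abs_of_nonneg hc2]
    nlinarith [abs_nonneg α]
  rcases le_or_gt ‖p‖ R₁ with hpR | hpR
  · have : c = 0 := hc0 hpR
    have hyz : y = z := by rw [hy, this]; simp
    rw [hyz]
    refine ⟨by linarith, ?_⟩
    have : |⟪p, z⟫ - α| ≤ ‖p‖ * ‖z‖ + M₀ := (abs_sub _ _).trans (add_le_add hin hα)
    nlinarith
  · have hp0 : 0 < ‖p‖ := by linarith
    constructor
    · have h1 : ‖(α * c * (‖p‖ ^ 2)⁻¹) • p‖ ≤ M₀ / ‖p‖ := by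
        rw [norm_smul, norm_mul, norm_inv, norm_pow, norm_norm, Real.norm_eq_abs, mul_assoc]
        have : (‖p‖ ^ 2)⁻¹ * ‖p‖ = 1 / ‖p‖ := by field_simp
        rw [this, mul_one_div]
        gcongr
      have h2 : (1 + ‖p‖) * (M₀ / ‖p‖) ≤ 2 * M₀ := by
        rw [← mul_div_assoc, div_le_iff₀ hp0]
        nlinarith
      have h3 : ‖y‖ ≤ ‖z‖ + M₀ / ‖p‖ := by
        rw [hy]; exact (norm_add_le _ _).trans (by linarith)
      nlinarith
    · have h1 : ⟪p, y⟫ - α = ⟪p, z⟫ + α * (c - 1) := by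
        rw [hy, inner_add_right, inner_smul_right, real_inner_self_eq_norm_sq]
        field_simp
        ring
      have h2 : |⟪p, y⟫ - α| ≤ ‖p‖ * ‖z‖ + |α * (c - 1)| := by
        rw [h1]; exact (abs_add_le _ _).trans (by linarith)
      have h3 : (1 + ‖p‖) * |α * (c - 1)| ≤ M₀ * (R₁ + 2) := by
        rcases le_or_gt (R₁ + 1) ‖p‖ with h4 | h4
        · rw [hc1 h4]; simp; positivity
        · have : |α * (c - 1)| ≤ M₀ := by
            rw [abs_mul, abs_of_nonpos (by linarith : c - 1 ≤ 0)]
            nlinarith [abs_nonneg α]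
          nlinarith
      nlinarith

lemma aux_flow (T K : ℝ) (hK : 0 ≤ K) (Y : E → E) (q : ℝ → E)
    (hY : ∀ p, (1 + ‖p‖) * ‖Y p‖ ≤ K)
    (hq : ∀ t ∈ Set.Icc (0 : ℝ) T, HasDerivWithinAt q (Y (q t)) (Set.Icc (0 : ℝ) T) t) :
    ∀ t ∈ Set.Icc (0 : ℝ) T, ‖q t - q 0‖ ≤ K * T := by
  intro t ht
  have hb : ∀ p, ‖Y p‖ ≤ K := fun p => by
    nlinarith [hY p, norm_nonneg p, norm_nonneg (Y p), mul_nonneg (norm_nonneg p) (norm_nonneg (Y p))]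
  have := norm_image_sub_le_of_norm_deriv_le_segment' hq (fun x _ => hb _) t ht
  refine this.trans ?_
  have := ht.2
  gcongr
  linarith

lemma aux_sq (T K K₂ α : ℝ) (hK : 0 ≤ K) (hT : 0 ≤ T) (hK₂ : 0 ≤ K₂) (Y : E → E) (q : ℝ → E)
    (hY : ∀ p, (1 + ‖p‖) * ‖Y p‖ ≤ K)
    (hY2 : ∀ p, (1 + ‖p‖) * |⟪p, Y p⟫ - α| ≤ K₂)
    (hq : ∀ t ∈ Set.Icc (0 : ℝ) T, HasDerivWithinAt q (Y (q t)) (Set.Icc (0 : ℝ) T) t) :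
    ∀ t ∈ Set.Icc (0 : ℝ) T, |(‖q t‖ ^ 2 - ‖q 0‖ ^ 2) / 4 - α * t / 2| ≤
      (K₂ * (1 + K * T) * T) * (1 + ‖q 0‖)⁻¹ := by
  intro t ht
  have hf := aux_flow T K hK Y q hY hq
  have hr : 0 < 1 + ‖q 0‖ := by positivity
  have hd : ∀ s ∈ Set.Icc (0 : ℝ) T, HasDerivWithinAt (fun s => ‖q s‖ ^ 2 / 4 - α / 2 * s)
      (2 * ⟪q s, Y (q s)⟫ / 4 - α / 2) (Set.Icc (0 : ℝ) T) s := by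
    intro s hs
    have h1 := ((hq s hs).norm_sq.div_const 4).sub
      (((hasDerivAt_id s).const_mul (α / 2)).hasDerivWithinAt (s := Set.Icc (0 : ℝ) T))
    exact h1.congr_deriv (by simp)
  have hb : ∀ s ∈ Set.Ico (0 : ℝ) T, ‖2 * ⟪q s, Y (q s)⟫ / 4 - α / 2‖ ≤
      K₂ * (1 + K * T) * (1 + ‖q 0‖)⁻¹ := by
    intro s hs
    have h1 := hf s ⟨hs.1, hs.2.le⟩
    have h2 := hY2 (q s)
    have h3 : ‖q 0‖ ≤ ‖q s‖ + K * T := by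
      have := norm_sub_norm_le (q 0) (q s)
      rw [norm_sub_rev] at this
      linarith
    have hn := norm_nonneg (q s)
    have hKT : 0 ≤ K * T := by positivity
    have h4 : 1 + ‖q 0‖ ≤ (1 + K * T) * (1 + ‖q s‖) := by nlinarith
    have e : 2 * ⟪q s, Y (q s)⟫ / 4 - α / 2 = (⟪q s, Y (q s)⟫ - α) / 2 := by ring
    rw [e, Real.norm_eq_abs, abs_div, ← div_eq_mul_inv, le_div_iff₀ hr, abs_two]
    have ha := abs_nonneg (⟪q s, Y (q s)⟫ - α)
    set a := |⟪q s, Y (q s)⟫ - α|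
    calc a / 2 * (1 + ‖q 0‖) ≤ a * (1 + ‖q 0‖) := by nlinarith
      _ ≤ a * ((1 + K * T) * (1 + ‖q s‖)) := by gcongr
      _ = (1 + K * T) * ((1 + ‖q s‖) * a) := by ring
      _ ≤ (1 + K * T) * K₂ := by gcongr
      _ = _ := by ring
  have h := norm_image_sub_le_of_norm_deriv_le_segment' hd hb t ht
  rw [Real.norm_eq_abs] at h
  have e : ‖q t‖ ^ 2 / 4 - α / 2 * t - (‖q 0‖ ^ 2 / 4 - α / 2 * 0) =
    (‖q t‖ ^ 2 - ‖q 0‖ ^ 2) / 4 - α * t / 2 := by ring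
  rw [e] at h
  refine h.trans ?_
  have h5 : t - 0 ≤ T := by linarith [ht.2]
  have hKT : 0 ≤ K * T := by positivity
  calc K₂ * (1 + K * T) * (1 + ‖q 0‖)⁻¹ * (t - 0) ≤ K₂ * (1 + K * T) * (1 + ‖q 0‖)⁻¹ * T := by gcongr
    _ = _ := by ring

lemma aux_D (T K C₀ : ℝ) (hK : 0 ≤ K) (hT : 0 ≤ T) (hC₀ : 0 < C₀) (Y : E → E) (Φ : ℝ → E → E)
    (hYd : Differentiable ℝ Y)
    (hY : ∀ p, (1 + ‖p‖) * ‖Y p‖ ≤ K)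
    (hY2 : ∀ p, (1 + ‖p‖) ^ 2 * ‖fderiv ℝ Y p‖ ≤ C₀)
    (hΦd : ∀ t ∈ Set.Icc (0 : ℝ) T, Differentiable ℝ (Φ t))
    (hΦ0 : ∀ p, Φ 0 p = p)
    (hΦ : ∀ p, ∀ t ∈ Set.Icc (0 : ℝ) T,
          HasDerivWithinAt (fun s => Φ s p) (Y (Φ t p)) (Set.Icc (0 : ℝ) T) t) :
    ∀ t ∈ Set.Icc (0 : ℝ) T, ∀ p, ‖fderiv ℝ (Φ t) p - ContinuousLinearMap.id ℝ E‖ ≤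
      (C₀ * (2 + K * T) ^ 2 * T * rexp (C₀ * (2 + K * T) ^ 2 * T)) * (1 + ‖p‖)⁻¹ := by
  intro t ht p
  have hKT : 0 ≤ K * T := by positivity
  have hr : 0 < 1 + ‖p‖ := by positivity
  have hr1 : 1 ≤ 1 + ‖p‖ := by linarith [norm_nonneg p]
  set L₀ := C₀ * (2 + K * T) ^ 2 with hL₀
  have hL₀p : 0 < L₀ := by positivity
  set L := L₀ / (1 + ‖p‖) ^ 2 with hL
  have hLp : 0 < L := by positivity
  have hLL : L ≤ L₀ * (1 + ‖p‖)⁻¹ := by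
    rw [hL, div_eq_mul_inv]
    gcongr
    nlinarith
  have hLL0 : L ≤ L₀ := by
    refine hLL.trans ?_
    have := inv_le_one_of_one_le₀ hr1
    nlinarith
  have hlip : ∀ x ∈ closedBall p (K * T + 1), ∀ y ∈ closedBall p (K * T + 1),
      ‖Y y - Y x‖ ≤ L * ‖y - x‖ := by
    intro x hx y hy
    refine Convex.norm_image_sub_le_of_norm_fderiv_le (𝕜 := ℝ) (s := closedBall p (K * T + 1))
      (fun x _ => hYd x) ?_ (convex_closedBall _ _) hx hy
    intro z hz
    rw [mem_closedBall, dist_eq_norm] at hz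
    have h3 : ‖p‖ ≤ ‖z‖ + (K * T + 1) := by
      have := norm_sub_norm_le p z
      rw [norm_sub_rev] at this
      linarith
    have hn := norm_nonneg z
    have h4 : 1 + ‖p‖ ≤ (2 + K * T) * (1 + ‖z‖) := by nlinarith
    rw [hL, le_div_iff₀ (by positivity), hL₀]
    calc ‖fderiv ℝ Y z‖ * (1 + ‖p‖) ^ 2 ≤ ‖fderiv ℝ Y z‖ * ((2 + K * T) * (1 + ‖z‖)) ^ 2 := by
          gcongr
      _ = ((1 + ‖z‖) ^ 2 * ‖fderiv ℝ Y z‖) * (2 + K * T) ^ 2 := by ring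
      _ ≤ C₀ * (2 + K * T) ^ 2 := by gcongr; exact hY2 z
  have hmem : ∀ p' ∈ closedBall p 1, ∀ s ∈ Set.Icc (0 : ℝ) T, Φ s p' ∈ closedBall p (K * T + 1) := by
    intro p' hp' s hs
    have := aux_flow T K hK Y (fun s => Φ s p') hY (hΦ p') s hs
    simp only [hΦ0] at this
    rw [mem_closedBall, dist_eq_norm] at hp' ⊢
    have e : Φ s p' - p = (Φ s p' - p') + (p' - p) := by abel
    rw [e]
    exact (norm_add_le _ _).trans (add_le_add this hp')
  have key : ∀ p' ∈ closedBall p 1, ‖(Φ t p' - p') - (Φ t p - p)‖ ≤ (rexp (L * t) - 1) * ‖p' - p‖ := by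
    intro p' hp'
    have hd : ∀ s ∈ Set.Icc (0 : ℝ) T, HasDerivWithinAt (fun s => (Φ s p' - p') - (Φ s p - p))
        (Y (Φ s p') - Y (Φ s p)) (Set.Icc (0 : ℝ) T) s := fun s hs =>
      ((hΦ p' s hs).sub_const p').sub ((hΦ p s hs).sub_const p)
    have hg := norm_le_gronwallBound_of_norm_deriv_right_le (f := fun s => (Φ s p' - p') - (Φ s p - p))
      (f' := fun s => Y (Φ s p') - Y (Φ s p)) (δ := 0) (K := L) (ε := L * ‖p' - p‖) (a := 0) (b := T)
      (fun s hs => (hd s hs).continuousWithinAt)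
      (fun s hs => (hd s ⟨hs.1, hs.2.le⟩).mono_of_mem_nhdsWithin
        (mem_of_superset (Icc_mem_nhdsGE hs.2) (Icc_subset_Icc_left hs.1)))
      (by simp [hΦ0])
      (by
        intro s hs
        have hs' : s ∈ Set.Icc (0 : ℝ) T := ⟨hs.1, hs.2.le⟩
        refine (hlip _ (hmem p (by simp) s hs') _ (hmem p' hp' s hs')).trans ?_
        rw [← mul_add]
        refine mul_le_mul_of_nonneg_left ?_ hLp.le
        have e : Φ s p' - Φ s p = ((Φ s p' - p') - (Φ s p - p)) + (p' - p) := by abel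
        rw [e]
        exact norm_add_le _ _) t ht
    rw [gronwallBound_of_K_ne_0 hLp.ne'] at hg
    refine hg.trans (le_of_eq ?_)
    rw [sub_zero]
    field_simp
    ring
  have hexp : rexp (L * t) - 1 ≤ (L₀ * T * rexp (L₀ * T)) * (1 + ‖p‖)⁻¹ := by
    have ht0 : 0 ≤ t := ht.1
    have htT : t ≤ T := ht.2
    have h1 := (le_abs_self _).trans (aux_exp (L * t))
    rw [abs_of_nonneg (by positivity : 0 ≤ L * t)] at h1
    refine h1.trans ?_
    calc L * t * rexp (L * t) ≤ (L₀ * (1 + ‖p‖)⁻¹) * T * rexp (L₀ * T) := by gcongr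
      _ = _ := by ring
  refine le_trans ?_ hexp
  have hfd : HasFDerivAt (fun x => Φ t x - x) (fderiv ℝ (Φ t) p - ContinuousLinearMap.id ℝ E) p :=
    ((hΦd t ht) p).hasFDerivAt.sub (hasFDerivAt_id p)
  refine hfd.le_of_lip' ?_ ?_
  · have : 0 ≤ L * t := mul_nonneg hLp.le ht.1
    linarith [Real.add_one_le_exp (L * t)]
  · filter_upwards [closedBall_mem_nhds p one_pos] with x hx using key x hx

end gen

lemma aux_frame (n : ℕ) (v : Euc n) (hv : v ∈ Sph n) :
    ∃ τ : Fin n → Euc n, Orthonormal ℝ τ ∧ ∀ i, ⟪τ i, v⟫ = 0 := by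
  have hv0 : v ≠ 0 := by
    rintro rfl
    simp [Sph] at hv
  have : Fact (Module.finrank ℝ (Euc n) = n + 1) := ⟨by simp⟩
  have hf := Submodule.finrank_orthogonal_span_singleton (𝕜 := ℝ) (n := n) hv0
  let b := (stdOrthonormalBasis ℝ ((Submodule.span ℝ {v})ᗮ : Submodule ℝ (Euc n))).reindex (finCongr hf)
  refine ⟨fun i => (b i : Euc n), ?_, ?_⟩
  · exact b.orthonormal.comp_linearIsometry (Submodule.subtypeₗᵢ _)
  · intro i
    exact Submodule.mem_orthogonal_singleton_iff_inner_left.1 (b i).2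

lemma aux_gram {n : ℕ} (D : Euc n →L[ℝ] Euc n) (δ : ℝ)
    (hD : ‖D - ContinuousLinearMap.id ℝ (Euc n)‖ ≤ δ) (τ : Fin n → Euc n) (hτ : Orthonormal ℝ τ)
    (i j : Fin n) : |⟪D (τ i), D (τ j)⟫ - (1 : Matrix (Fin n) (Fin n) ℝ) i j| ≤ 2 * δ + δ ^ 2 := by
  have h1 : ∀ i, ‖D (τ i) - τ i‖ ≤ δ := by
    intro i
    have := (D - ContinuousLinearMap.id ℝ (Euc n)).le_opNorm (τ i)
    rw [hτ.1 i, mul_one] at this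
    exact this.trans hD
  have h0 : ⟪τ i, τ j⟫ = (1 : Matrix (Fin n) (Fin n) ℝ) i j := by
    rw [Matrix.one_apply]
    exact orthonormal_iff_ite.1 hτ i j
  have e : ⟪D (τ i), D (τ j)⟫ - (1 : Matrix (Fin n) (Fin n) ℝ) i j =
      ⟪D (τ i) - τ i, τ j⟫ + ⟪τ i, D (τ j) - τ j⟫ + ⟪D (τ i) - τ i, D (τ j) - τ j⟫ := by
    rw [← h0]
    simp only [inner_sub_left, inner_sub_right]
    ring
  have a1 := abs_real_inner_le_norm (D (τ i) - τ i) (τ j)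
  have a2 := abs_real_inner_le_norm (τ i) (D (τ j) - τ j)
  have a3 := abs_real_inner_le_norm (D (τ i) - τ i) (D (τ j) - τ j)
  rw [hτ.1 j, mul_one] at a1
  rw [hτ.1 i, one_mul] at a2
  have hi := h1 i
  have hj := h1 j
  have a4 : ‖D (τ i) - τ i‖ * ‖D (τ j) - τ j‖ ≤ δ * δ :=
    mul_le_mul hi hj (norm_nonneg _) ((norm_nonneg _).trans hi)
  rw [e]
  refine (abs_add_le _ _).trans ?_
  have := abs_add_le ⟪D (τ i) - τ i, τ j⟫ ⟪τ i, D (τ j) - τ j⟫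
  nlinarith

/-- expansion of the expander Jacobian
`J^EΦ = JΦ · e^{(|Φ|²−|p|²)/4}`; cf. the proof of Lemma 4.5 in Bernstein–Wang. With
`c(α,t) = 1 + αt/2 + ((αt)²/4)∫₀¹ e^{αtρ/2}(1−ρ)dρ`, one has
`|JΦ · e^{(|Φ|²−|p|²)/4} − c(α,t)| ≤ C (1+|p|)⁻¹` with `C` depending only on `n`, `ℛ₁`,
`M₀`, `C₀` and `T`. -/
theorem expander_jacobian_estimate
    (n : ℕ) (hn : 2 ≤ n) (R₁ M₀ C₀ T : ℝ)
    (hR₁ : 1 < R₁) (hM₀ : 0 < M₀) (hC₀ : 0 < C₀) (hT : 0 < T) :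
    ∃ C : ℝ, 0 < C ∧
      ∀ (χ : Euc n → ℝ) (α : ℝ) (Y : Euc n → Euc n) (Φ : ℝ → Euc n → Euc n)
        (J : ℝ → Euc n → Euc n → ℝ),
        ContDiff ℝ (⊤ : ℕ∞) χ → (∀ p, χ p ∈ Set.Icc (0 : ℝ) 1) →
        (∀ p : Euc n, ‖p‖ ≤ R₁ → χ p = 0) → (∀ p : Euc n, R₁ + 1 ≤ ‖p‖ → χ p = 1) →
        |α| ≤ M₀ → ContDiff ℝ (⊤ : ℕ∞) Y →
        (∀ p : Euc n, (1 + ‖p‖) ^ 3 * ‖Y p - (α * χ p * (‖p‖ ^ 2)⁻¹) • p‖ ≤ C₀) →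
        (∀ p : Euc n, (1 + ‖p‖) ^ 2 * (‖iteratedFDeriv ℝ 1 Y p‖ +
          ‖iteratedFDeriv ℝ 2 Y p‖ + ‖iteratedFDeriv ℝ 3 Y p‖) ≤ C₀) →
        ContDiffOn ℝ (⊤ : ℕ∞) (fun q : ℝ × Euc n => Φ q.1 q.2)
          (Set.Icc (0 : ℝ) T ×ˢ Set.univ) →
        (∀ t ∈ Set.Icc (0 : ℝ) T, ContDiff ℝ (⊤ : ℕ∞) (Φ t)) →
        (∀ p, Φ 0 p = p) →
        (∀ p, ∀ t ∈ Set.Icc (0 : ℝ) T,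
          HasDerivWithinAt (fun s => Φ s p) (Y (Φ t p)) (Set.Icc (0 : ℝ) T) t) →
        (∀ (t : ℝ) (p v : Euc n), v ∈ Sph n →
          ∀ τ : Fin n → Euc n, Orthonormal ℝ τ → (∀ i, ⟪τ i, v⟫ = 0) →
            J t p v = Real.sqrt (Matrix.det (Matrix.of fun i j =>
              ⟪(fderiv ℝ (Φ t) p) (τ i), (fderiv ℝ (Φ t) p) (τ j)⟫))) →
        ∀ t ∈ Set.Icc (0 : ℝ) T, ∀ (p v : Euc n), v ∈ Sph n →
          |J t p v * Real.exp ((‖Φ t p‖ ^ 2 - ‖p‖ ^ 2) / 4) -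
              (1 + α * t / 2 + ((α * t) ^ 2 / 4) *
                ∫ ρ in (0 : ℝ)..1, Real.exp (α * t * ρ / 2) * (1 - ρ))| ≤
            C * (1 + ‖p‖)⁻¹ := by
  set K := C₀ + 2 * M₀ with hK
  set K₂ := C₀ + M₀ * (R₁ + 2) with hK₂
  have hKp : 0 < K := by positivity
  have hK₂p : 0 < K₂ := by positivity
  set A := K₂ * (1 + K * T) * T with hA
  have hAp : 0 < A := by positivity
  set B := C₀ * (2 + K * T) ^ 2 * T * rexp (C₀ * (2 + K * T) ^ 2 * T) with hB
  have hBp : 0 < B := by positivity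
  obtain ⟨Cd, hCd, hdet⟩ := aux_det n ((2 + B) * B) (by positivity)
  refine ⟨Cd * ((2 + B) * B) * rexp (M₀ * T / 2 + A) + rexp (M₀ * T / 2) * (A * rexp A),
    by positivity, ?_⟩
  intro χ α Y Φ J hχ hχ01 hχ0 hχ1 hα hYs hY1 hY2 hΦs hΦd hΦ0 hΦ hJ t ht p v hv
  have hYa := fun p => aux_Y R₁ M₀ C₀ α (χ p) hR₁ hα p (Y p) (hχ01 p) (hχ0 p) (hχ1 p) (hY1 p)
  have hYb : ∀ p, (1 + ‖p‖) ^ 2 * ‖fderiv ℝ Y p‖ ≤ C₀ := by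
    intro p
    refine le_trans ?_ (hY2 p)
    rw [norm_iteratedFDeriv_one]
    refine mul_le_mul_of_nonneg_left ?_ (by positivity)
    have h2 := norm_nonneg (iteratedFDeriv ℝ 2 Y p)
    have h3 := norm_nonneg (iteratedFDeriv ℝ 3 Y p)
    linarith
  have hD := aux_D T K C₀ hKp.le hT.le hC₀ Y Φ (hYs.differentiable (by simp))
    (fun p => (hYa p).1) hYb (fun t ht => (hΦd t ht).differentiable (by simp)) hΦ0 hΦ t ht p
  have hE := aux_sq T K K₂ α hKp.le hT.le hK₂p.le Y (fun s => Φ s p)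
    (fun p => (hYa p).1) (fun p => (hYa p).2) (hΦ p) t ht
  simp only [hΦ0] at hE
  rw [← hB] at hD
  rw [← hA] at hE
  obtain ⟨τ, hτ, hτv⟩ := aux_frame n v hv
  have hJ' := hJ t p v hv τ hτ hτv
  rw [aux_int]
  have hr1 : 1 ≤ 1 + ‖p‖ := by linarith [norm_nonneg p]
  set r := (1 + ‖p‖)⁻¹ with hr
  have hr0 : 0 < r := by positivity
  have hr2 : r ≤ 1 := inv_le_one_of_one_le₀ hr1
  have hJ1 : |J t p v - 1| ≤ Cd * ((2 + B) * B) * r := by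
    rw [hJ']
    refine (aux_sqrt _).trans ?_
    rw [mul_assoc]
    refine hdet _ ((2 + B) * B * r) (by positivity) ?_ ?_
    · exact mul_le_of_le_one_right (by positivity) hr2
    · intro i j
      refine (aux_gram _ _ hD τ hτ i j).trans ?_
      have : r ^ 2 ≤ r := by nlinarith
      have := mul_le_mul_of_nonneg_left this (by positivity : 0 ≤ B ^ 2)
      nlinarith
  set ε := (‖Φ t p‖ ^ 2 - ‖p‖ ^ 2) / 4 - α * t / 2 with hε
  have hεe : (‖Φ t p‖ ^ 2 - ‖p‖ ^ 2) / 4 = α * t / 2 + ε := by rw [hε]; ring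
  have hεA : |ε| ≤ A := hE.trans (mul_le_of_le_one_right hAp.le hr2)
  have hαt : α * t / 2 ≤ M₀ * T / 2 := by
    have h1 : α * t ≤ M₀ * t := mul_le_mul_of_nonneg_right ((le_abs_self _).trans hα) ht.1
    have h2 : M₀ * t ≤ M₀ * T := mul_le_mul_of_nonneg_left ht.2 hM₀.le
    linarith
  rw [hεe]
  have e : J t p v * rexp (α * t / 2 + ε) - rexp (α * t / 2) =
      (J t p v - 1) * rexp (α * t / 2 + ε) + rexp (α * t / 2) * (rexp ε - 1) := by
    rw [Real.exp_add]; ring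
  rw [e]
  refine (abs_add_le _ _).trans ?_
  rw [abs_mul, abs_mul, Real.abs_exp, Real.abs_exp, add_mul]
  refine add_le_add ?_ ?_
  · calc |J t p v - 1| * rexp (α * t / 2 + ε)
        ≤ (Cd * ((2 + B) * B) * r) * rexp (M₀ * T / 2 + A) := by
          gcongr
          exact (le_abs_self _).trans hεA
      _ = _ := by ring
  · calc rexp (α * t / 2) * |rexp ε - 1|
        ≤ rexp (M₀ * T / 2) * ((A * r) * rexp A) := by
          gcongr
          refine (aux_exp ε).trans ?_
          gcongr
      _ = _ := by ring
end
end

section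
/- Let n ≥ 2 and let R₂, C̄, ℛ₁, N, χ and Y₀ be as in the context. Then there is a constant C > 0, depending only on n and C̄, such that for every p ∈ ℝ^{n+1} with |p| ≥ ℛ₁ + 1 and every v ∈ S^n: | div Y₀(p) − (∇Y₀(p)v)·v + (1/2) p·Y₀(p) − 1/2 | ≤ C(1+|p|)^{-1}, where div Y₀(p) is the trace of ∇Y₀(p). -/
noncomputable section

open Set Metric Real Filter
open scoped RealInnerProductSpace

lemma aux_trace (n : ℕ) (A : Euc n →L[ℝ] Euc n) (K : ℝ) (hK : ∀ w, ‖A w‖ ≤ K * ‖w‖) :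
    |LinearMap.trace ℝ (Euc n) A.toLinearMap| ≤ (n + 1) * K := by
  rw [LinearMap.trace_eq_sum_inner _ (EuclideanSpace.basisFun (Fin (n+1)) ℝ)]
  refine (Finset.abs_sum_le_sum_abs _ _).trans ?_
  have : ∀ i ∈ (Finset.univ : Finset (Fin (n+1))),
      |⟪(EuclideanSpace.basisFun (Fin (n+1)) ℝ) i,
        A.toLinearMap ((EuclideanSpace.basisFun (Fin (n+1)) ℝ) i)⟫| ≤ K := by
    intro i _
    refine (abs_real_inner_le_norm _ _).trans ?_
    have h1 : ‖(EuclideanSpace.basisFun (Fin (n+1)) ℝ) i‖ = 1 :=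
      (EuclideanSpace.basisFun (Fin (n+1)) ℝ).orthonormal.1 i
    have := hK ((EuclideanSpace.basisFun (Fin (n+1)) ℝ) i)
    rw [h1] at this ⊢
    simpa using this
  refine (Finset.sum_le_sum this).trans ?_
  simp

lemma aux_deriv (n : ℕ) (N : Euc n → Euc n) (χ : Euc n → ℝ) (p : Euc n) (N' : Euc n →L[ℝ] Euc n)
    (hN : HasFDerivAt N N' p) (hχ : HasFDerivAt χ (0 : Euc n →L[ℝ] ℝ) p) (h1 : χ p = 1)
    (hp : p ≠ 0) (w : Euc n) :
    fderiv ℝ (fun p => (χ p * (‖p‖ ^ 2)⁻¹) • (p - ⟪p, N p⟫ • N p)) p w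
      = (‖p‖ ^ 2)⁻¹ • (w - ((⟪p, N' w⟫ + ⟪w, N p⟫) • N p + ⟪p, N p⟫ • N' w))
        + (-(2 * ⟪p, w⟫) * ((‖p‖ ^ 2)⁻¹) ^ 2) • (p - ⟪p, N p⟫ • N p) := by
  have hsq : HasFDerivAt (fun p : Euc n => ‖p‖ ^ 2) (2 • innerSL ℝ p) p :=
    (hasStrictFDerivAt_norm_sq p).hasFDerivAt
  have hne : ‖p‖ ^ 2 ≠ 0 := by positivity
  have hinv := (hasDerivAt_inv hne).comp_hasFDerivAt p hsq
  have hφ := hχ.mul hinv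
  have hf := (hasFDerivAt_id p).inner ℝ hN
  have hW := (hasFDerivAt_id p).sub (hf.smul hN)
  have hY := hφ.smul hW
  have := hY.fderiv
  have h2 := congrArg (fun L : Euc n →L[ℝ] Euc n => L w) this
  refine Eq.trans ?_ (h2.trans ?_)
  · rfl
  · simp [h1]
    module

lemma aux_bound (n : ℕ) (p ν w : Euc n) (N' : Euc n →L[ℝ] Euc n) (C' : ℝ) (hp : 1 ≤ ‖p‖)
    (hν : ‖ν‖ = 1) (h : |⟪p, ν⟫| + ‖N'‖ ≤ C' * (1 + ‖p‖)⁻¹) (hC' : 0 < C') :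
    ‖(‖p‖ ^ 2)⁻¹ • (w - ((⟪p, N' w⟫ + ⟪w, ν⟫) • ν + ⟪p, ν⟫ • N' w))
        + (-(2 * ⟪p, w⟫) * ((‖p‖ ^ 2)⁻¹) ^ 2) • (p - ⟪p, ν⟫ • ν)‖
      ≤ ((6 + C' + C' ^ 2) * (‖p‖ ^ 2)⁻¹) * ‖w‖ := by
  have hr : 0 < ‖p‖ := by linarith
  have hinv : (1 + ‖p‖)⁻¹ ≤ 1 := inv_le_one_of_one_le₀ (by linarith)
  have hf : |⟪p, ν⟫| ≤ C' := by nlinarith [norm_nonneg N']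
  have hN1 : ‖N'‖ ≤ C' := by nlinarith [abs_nonneg ⟪p, ν⟫]
  have hN2 : ‖p‖ * ‖N'‖ ≤ C' := by
    have : ‖N'‖ ≤ C' * (1 + ‖p‖)⁻¹ := by linarith [abs_nonneg ⟪p, ν⟫]
    calc ‖p‖ * ‖N'‖ ≤ (1 + ‖p‖) * (C' * (1 + ‖p‖)⁻¹) := by gcongr; linarith
      _ = C' := by field_simp
  have hNw := N'.le_opNorm w
  have hw := norm_nonneg w
  have hpw := abs_real_inner_le_norm p w
  have hwν : |⟪w, ν⟫| ≤ ‖w‖ := by simpa [hν] using abs_real_inner_le_norm w ν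
  have hpν : |⟪p, ν⟫| ≤ ‖p‖ := by simpa [hν] using abs_real_inner_le_norm p ν
  have hpN : |⟪p, N' w⟫| ≤ C' * ‖w‖ := by
    calc _ ≤ ‖p‖ * ‖N' w‖ := abs_real_inner_le_norm _ _
      _ ≤ ‖p‖ * (‖N'‖ * ‖w‖) := by gcongr
      _ = (‖p‖ * ‖N'‖) * ‖w‖ := by ring
      _ ≤ _ := by gcongr
  have hA : ‖w - ((⟪p, N' w⟫ + ⟪w, ν⟫) • ν + ⟪p, ν⟫ • N' w)‖ ≤ (2 + C' + C' ^ 2) * ‖w‖ := by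
    calc _ ≤ ‖w‖ + (‖(⟪p, N' w⟫ + ⟪w, ν⟫) • ν‖ + ‖⟪p, ν⟫ • N' w‖) :=
          (norm_sub_le _ _).trans (by gcongr; exact norm_add_le _ _)
      _ = ‖w‖ + (|⟪p, N' w⟫ + ⟪w, ν⟫| + |⟪p, ν⟫| * ‖N' w‖) := by
          simp only [norm_smul, hν, Real.norm_eq_abs, mul_one]
      _ ≤ ‖w‖ + ((C' * ‖w‖ + ‖w‖) + C' * (C' * ‖w‖)) := by
          gcongr
          · exact (abs_add_le _ _).trans (by linarith)
          · exact hNw.trans (by gcongr)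
      _ = _ := by ring
  have hB : ‖p - ⟪p, ν⟫ • ν‖ ≤ 2 * ‖p‖ := by
    refine (norm_sub_le _ _).trans ?_
    rw [norm_smul, hν, Real.norm_eq_abs]; linarith
  refine (norm_add_le _ _).trans ?_
  rw [norm_smul, norm_smul]
  have e1 : ‖(‖p‖ ^ 2)⁻¹‖ = (‖p‖ ^ 2)⁻¹ := by
    rw [Real.norm_eq_abs, abs_of_nonneg (by positivity)]
  have e2 : ‖-(2 * ⟪p, w⟫) * ((‖p‖ ^ 2)⁻¹) ^ 2‖ = 2 * |⟪p, w⟫| * ((‖p‖ ^ 2)⁻¹) ^ 2 := by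
    rw [Real.norm_eq_abs, abs_mul, abs_neg, abs_mul, abs_of_nonneg (a := ((‖p‖ ^ 2)⁻¹) ^ 2) (by positivity)]
    norm_num
  rw [e1, e2]
  calc _ ≤ (‖p‖ ^ 2)⁻¹ * ((2 + C' + C' ^ 2) * ‖w‖)
        + 2 * (‖p‖ * ‖w‖) * ((‖p‖ ^ 2)⁻¹) ^ 2 * (2 * ‖p‖) := by gcongr
    _ = _ := by field_simp; ring

/-- the expander divergence of `Y₀` is asymptotically `1/2`; used in the
proof of Proposition 5.5 in Bernstein–Wang. For `|p| ≥ ℛ₁ + 1` and `v ∈ 𝕊ⁿ`,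
`|div Y₀(p) − (∇Y₀(p)v)·v + (1/2) p·Y₀(p) − 1/2| ≤ C(1+|p|)⁻¹`, with `C` depending only
on `n` and `C̄`. -/
theorem Y0_expander_divergence
    (n : ℕ) (hn : 2 ≤ n) (C' : ℝ) (hC' : 0 < C') :
    ∃ C : ℝ, 0 < C ∧
      ∀ (R₂ R₁ : ℝ), 1 < R₂ → R₂ < R₁ →
      ∀ (N : Euc n → Euc n), ContDiffOn ℝ (⊤ : ℕ∞) N {p : Euc n | R₂ < ‖p‖} →
        (∀ p : Euc n, R₂ < ‖p‖ → ‖N p‖ = 1) →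
        (∀ p : Euc n, R₂ < ‖p‖ →
          |⟪p, N p⟫| + ‖iteratedFDeriv ℝ 1 N p‖ + ‖iteratedFDeriv ℝ 2 N p‖ +
            ‖iteratedFDeriv ℝ 3 N p‖ ≤ C' * (1 + ‖p‖)⁻¹) →
      ∀ (χ : Euc n → ℝ), ContDiff ℝ (⊤ : ℕ∞) χ → (∀ p, χ p ∈ Set.Icc (0 : ℝ) 1) →
        (∀ p : Euc n, ‖p‖ ≤ R₁ → χ p = 0) → (∀ p : Euc n, R₁ + 1 ≤ ‖p‖ → χ p = 1) →
      ∀ (Y₀ : Euc n → Euc n), ContDiff ℝ (⊤ : ℕ∞) Y₀ →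
        (∀ p : Euc n, ‖p‖ ≤ R₁ → Y₀ p = 0) →
        (∀ p : Euc n, R₁ < ‖p‖ →
          Y₀ p = (χ p * (‖p‖ ^ 2)⁻¹) • (p - ⟪p, N p⟫ • N p)) →
      ∀ p : Euc n, R₁ + 1 ≤ ‖p‖ → ∀ v ∈ Sph n,
        |LinearMap.trace ℝ (Euc n) (fderiv ℝ Y₀ p).toLinearMap -
            ⟪(fderiv ℝ Y₀ p) v, v⟫ + (1 / 2) * ⟪p, Y₀ p⟫ - 1 / 2| ≤
          C * (1 + ‖p‖)⁻¹ := by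
  refine ⟨2 * ((n + 2) * (6 + C' + C' ^ 2) + C' ^ 2), by positivity, ?_⟩
  intro R₂ R₁ hR₂ hR₁ N hN hN1 hNb χ hχ hχI _ hχ1 Y₀ _ _ hY p hp v hv
  have hr1 : 1 ≤ ‖p‖ := by linarith
  have hr : 0 < ‖p‖ := by linarith
  have hpR : R₂ < ‖p‖ := by linarith
  have hp0 : p ≠ 0 := norm_pos_iff.1 hr
  have hopen : IsOpen {p : Euc n | R₂ < ‖p‖} := isOpen_lt continuous_const continuous_norm
  have hNd : HasFDerivAt N (fderiv ℝ N p) p :=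
    ((hN.contDiffAt (hopen.mem_nhds hpR)).differentiableAt (by simp)).hasFDerivAt
  have hχ1p := hχ1 p hp
  have hχd : HasFDerivAt χ (0 : Euc n →L[ℝ] ℝ) p := by
    have hd := ((hχ.contDiffAt (x := p)).differentiableAt (by simp)).hasFDerivAt
    have hmax : IsLocalMax χ p := Filter.Eventually.of_forall fun q => by
      rw [hχ1p]; exact (hχI q).2
    rwa [hmax.fderiv_eq_zero] at hd
  have hopen1 : IsOpen {p : Euc n | R₁ < ‖p‖} := isOpen_lt continuous_const continuous_norm
  have hEq : Y₀ =ᶠ[nhds p] fun p => (χ p * (‖p‖ ^ 2)⁻¹) • (p - ⟪p, N p⟫ • N p) := by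
    filter_upwards [hopen1.mem_nhds (show R₁ < ‖p‖ by linarith)] with q hq
    exact hY q hq
  have hb := hNb p hpR
  have hn1 : ‖iteratedFDeriv ℝ 1 N p‖ = ‖fderiv ℝ N p‖ := norm_iteratedFDeriv_one N
  have hb' : |⟪p, N p⟫| + ‖fderiv ℝ N p‖ ≤ C' * (1 + ‖p‖)⁻¹ := by
    rw [← hn1]
    linarith [norm_nonneg (iteratedFDeriv ℝ 2 N p), norm_nonneg (iteratedFDeriv ℝ 3 N p)]
  have hA : ∀ w, ‖fderiv ℝ Y₀ p w‖ ≤ ((6 + C' + C' ^ 2) * (‖p‖ ^ 2)⁻¹) * ‖w‖ := by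
    intro w
    rw [hEq.fderiv_eq, aux_deriv n N χ p _ hNd hχd hχ1p hp0 w]
    exact aux_bound n p (N p) w _ C' hr1 (hN1 p hpR) hb' hC'
  have htr := aux_trace n _ _ hA
  have hv1 : ‖v‖ = 1 := by simpa [Sph] using hv
  have hin : |⟪(fderiv ℝ Y₀ p) v, v⟫| ≤ (6 + C' + C' ^ 2) * (‖p‖ ^ 2)⁻¹ := by
    refine (abs_real_inner_le_norm _ _).trans ?_
    have := hA v
    rw [hv1] at this ⊢
    linarith
  have hinv : (1 + ‖p‖)⁻¹ ≤ 1 := inv_le_one_of_one_le₀ (by linarith)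
  have hf : |⟪p, N p⟫| ≤ C' := by nlinarith [norm_nonneg (fderiv ℝ N p)]
  have hf2 : ⟪p, N p⟫ ^ 2 ≤ C' ^ 2 := sq_le_sq' (abs_le.1 hf).1 (abs_le.1 hf).2
  have hpY : (1 / 2) * ⟪p, Y₀ p⟫ - 1 / 2 = -(1 / 2) * (⟪p, N p⟫ ^ 2 * (‖p‖ ^ 2)⁻¹) := by
    rw [hY p (by linarith), hχ1p, inner_smul_right, inner_sub_right, inner_smul_right,
      real_inner_self_eq_norm_sq]
    field_simp
    ring
  have hi : (‖p‖ ^ 2)⁻¹ ≤ 2 * (1 + ‖p‖)⁻¹ := by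
    rw [← div_eq_mul_inv, inv_eq_one_div, div_le_div_iff₀ (by positivity) (by positivity)]
    nlinarith
  have hi0 : 0 ≤ (‖p‖ ^ 2)⁻¹ := by positivity
  have hq : ⟪p, N p⟫ ^ 2 * (‖p‖ ^ 2)⁻¹ ≤ C' ^ 2 * (‖p‖ ^ 2)⁻¹ := by gcongr
  have hq0 : 0 ≤ ⟪p, N p⟫ ^ 2 * (‖p‖ ^ 2)⁻¹ := by positivity
  have hfin : ((n + 2) * (6 + C' + C' ^ 2) + C' ^ 2) * (‖p‖ ^ 2)⁻¹ ≤
      ((n + 2) * (6 + C' + C' ^ 2) + C' ^ 2) * (2 * (1 + ‖p‖)⁻¹) := by gcongr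
  rw [add_sub_assoc, hpY]
  rw [abs_le] at htr hin ⊢
  constructor <;> nlinarith
end
end

section
/- Let n ≥ 2 and C > 1. There is a constant K > 0, depending only on n, with the following property. Let ψ : (ℝ^{n+1}∖{0}) × S^n → ℝ be a C² function whose support is a compact subset of (B_C ∖ B̄_{1/C}) × S^n, where B_r denotes the open ball of radius r about 0 and B̄_r its closure. For ρ ∈ (0,1) define ψ_ρ : ℝ^{n+1} × S^n → ℝ by ψ_ρ(p,v) = ρ^n e^{−|p|²/4} ψ(ρp, v) (extended by 0 where ρp ∉ B_C ∖ B̄_{1/C}). Then ψ_ρ ∈ 𝔛(ℝ^{n+1}) and ‖ψ_ρ‖_𝔛 ≤ K C ρ^{n−1} e^{−1/(4C²ρ²)} ‖ψ‖_{C²}, where ‖ψ‖_{C²} is the supremum of |ψ| together with the norms of its first and second derivatives on the Riemannian product (ℝ^{n+1}∖{0}) × S^n. -/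
/- Function spaces 𝔚, 𝔛, 𝔜′, 𝔜₀, 𝔜 on `Y × 𝕊ⁿ` from Bernstein–Wang,
"A mountain-pass theorem for asymptotically conical self-expanders". -/

noncomputable section

open Set Metric Real Filter
open scoped RealInnerProductSpace

/-- The set `Y × 𝕊ⁿ` inside `ℝ^{n+1} × ℝ^{n+1}`. -/
def pts {n : ℕ} (Y : Set (Euc n)) : Set (Euc n × Euc n) := Y ×ˢ Sph n

/-- The weight `(1+|p|)^{n+1} e^{|p|²/4}` appearing in the 𝔚-norm. -/
def wWeight (n : ℕ) (p : Euc n) : ℝ := (1 + ‖p‖) ^ (n + 1) * Real.exp (‖p‖ ^ 2 / 4)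

/-- The 𝔚-norm `sup (1+|p|)^{n+1} e^{|p|²/4} |ψ|` over `Y × 𝕊ⁿ`. -/
def WNorm {n : ℕ} (Y : Set (Euc n)) (ψ : Euc n × Euc n → ℝ) : ℝ :=
  sSup ((fun x => wWeight n x.1 * |ψ x|) '' pts Y)

/-- Membership in the space 𝔚(Y) of rapidly decaying continuous functions. -/
def memW {n : ℕ} (Y : Set (Euc n)) (ψ : Euc n × Euc n → ℝ) : Prop :=
  ContinuousOn ψ (pts Y) ∧ ∃ M : ℝ, ∀ x ∈ pts Y, wWeight n x.1 * |ψ x| ≤ M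

/-- Supremum norm over `Y × 𝕊ⁿ`. -/
def nsup {n : ℕ} {F : Type*} [NormedAddCommGroup F] (Y : Set (Euc n))
    (f : Euc n × Euc n → F) : ℝ :=
  sSup ((fun x => ‖f x‖) '' pts Y)

/-- The set of Lipschitz constants of `f` on `Y × 𝕊ⁿ` (with the metric induced from
`ℝ^{n+1} × ℝ^{n+1}`). -/
def lipSet {n : ℕ} {F : Type*} [NormedAddCommGroup F] (Y : Set (Euc n))
    (f : Euc n × Euc n → F) : Set ℝ :=
  {K : ℝ | 0 ≤ K ∧ ∀ x ∈ pts Y, ∀ y ∈ pts Y, ‖f x - f y‖ ≤ K * dist x y}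

/-- The Lipschitz norm `‖f‖_{Lip}`: sup norm plus best Lipschitz constant. -/
def LipNorm {n : ℕ} {F : Type*} [NormedAddCommGroup F] (Y : Set (Euc n))
    (f : Euc n × Euc n → F) : ℝ :=
  nsup Y f + sInf (lipSet Y f)

/-- `f` is bounded and Lipschitz on `Y × 𝕊ⁿ`. -/
def IsBddLip {n : ℕ} {F : Type*} [NormedAddCommGroup F] (Y : Set (Euc n))
    (f : Euc n × Euc n → F) : Prop :=
  (∃ M : ℝ, ∀ x ∈ pts Y, ‖f x‖ ≤ M) ∧ (lipSet Y f).Nonempty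

/-- `g` is the spherical gradient `∇_{𝕊ⁿ} ψ` on `Y × 𝕊ⁿ`: at each `(p,v) ∈ Y × 𝕊ⁿ`,
`g(p,v)` is orthogonal to `v` and is the gradient of `ψ(p,·)` at `v` along the sphere. -/
def IsSphereGrad {n : ℕ} (Y : Set (Euc n)) (ψ : Euc n × Euc n → ℝ)
    (g : Euc n × Euc n → Euc n) : Prop :=
  ∀ x ∈ pts Y,
    ⟪g x, x.2⟫ = 0 ∧
    HasFDerivWithinAt (fun v => ψ (x.1, v)) (innerSL ℝ (g x)) (Sph n) x.2

/-- The weighted gradient supremum `sup (1+|p|)|∇_{𝕊ⁿ}ψ|`. -/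
def gradWsup {n : ℕ} (Y : Set (Euc n)) (g : Euc n × Euc n → Euc n) : ℝ :=
  sSup ((fun x => (1 + ‖x.1‖) * ‖g x‖) '' pts Y)

/-- Membership in the space 𝔛(Y). -/
def memX {n : ℕ} (Y : Set (Euc n)) (ψ : Euc n × Euc n → ℝ) : Prop :=
  IsBddLip Y ψ ∧ ∃ g : Euc n × Euc n → Euc n, IsSphereGrad Y ψ g ∧ IsBddLip Y g ∧
    ∃ M : ℝ, ∀ x ∈ pts Y, (1 + ‖x.1‖) * ‖g x‖ ≤ M

/-- The 𝔛-norm `‖ψ‖_𝔛 = ‖ψ‖_{Lip} + ‖∇_{𝕊ⁿ}ψ‖_{Lip} + sup (1+|p|)|∇_{𝕊ⁿ}ψ|`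
(as an infimum over representatives of the spherical gradient). -/
def XNorm {n : ℕ} (Y : Set (Euc n)) (ψ : Euc n × Euc n → ℝ) : ℝ :=
  sInf {r : ℝ | ∃ g : Euc n × Euc n → Euc n, IsSphereGrad Y ψ g ∧
    r = LipNorm Y ψ + LipNorm Y g + gradWsup Y g}

/-- Membership in `𝔜′(Y) = 𝔛(Y) + 𝔚(Y)` (equality of functions on `Y × 𝕊ⁿ`). -/
def memYp {n : ℕ} (Y : Set (Euc n)) (ψ : Euc n × Euc n → ℝ) : Prop :=
  ∃ ζ ξ : Euc n × Euc n → ℝ, memX Y ζ ∧ memW Y ξ ∧ ∀ x ∈ pts Y, ψ x = ζ x + ξ x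

/-- The 𝔜-norm `‖ψ‖_𝔜 = inf {‖ζ‖_𝔛 + ‖ξ‖_𝔚 : ψ = ζ + ξ}`. -/
def YNorm {n : ℕ} (Y : Set (Euc n)) (ψ : Euc n × Euc n → ℝ) : ℝ :=
  sInf {r : ℝ | ∃ ζ ξ : Euc n × Euc n → ℝ, memX Y ζ ∧ memW Y ξ ∧
    (∀ x ∈ pts Y, ψ x = ζ x + ξ x) ∧ r = XNorm Y ζ + WNorm Y ξ}

/-- Continuous compactly supported functions on `Y × 𝕊ⁿ`. -/
def memCc {n : ℕ} (Y : Set (Euc n)) (φ : Euc n × Euc n → ℝ) : Prop :=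
  ContinuousOn φ (pts Y) ∧
    ∃ K : Set (Euc n × Euc n), IsCompact K ∧ ∀ x ∈ pts Y, x ∉ K → φ x = 0

/-- Membership in `𝔜₀(Y)`: the closure of `C⁰_c(Y × 𝕊ⁿ)` in `𝔜′(Y)`. -/
def memY0 {n : ℕ} (Y : Set (Euc n)) (ψ : Euc n × Euc n → ℝ) : Prop :=
  memYp Y ψ ∧ ∀ ε : ℝ, 0 < ε → ∃ φ, memCc Y φ ∧ YNorm Y (fun x => ψ x - φ x) < ε

/-- Membership in `𝔜(Y) = ℝ·𝟙 ⊕ 𝔜₀(Y)`. -/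
def memY {n : ℕ} (Y : Set (Euc n)) (ψ : Euc n × Euc n → ℝ) : Prop :=
  ∃ (c : ℝ) (φ : Euc n × Euc n → ℝ), memY0 Y φ ∧ ∀ x ∈ pts Y, ψ x = c + φ x

lemma aux_exp_s18 {a b m M : ℝ} (hm : 0 ≤ m) (ha : m ≤ a) (hb : m ≤ b) (haM : a ≤ M) (hbM : b ≤ M) :
    |Real.exp (-(a ^ 2) / 4) - Real.exp (-(b ^ 2) / 4)| ≤
      Real.exp (-(m ^ 2) / 4) * (M / 2) * |a - b| := by
  wlog hab : a ≤ b generalizing a b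
  · rw [abs_sub_comm, abs_sub_comm a b]
    exact this hb ha hbM haM (le_of_not_ge hab)
  have h1 : Real.exp (-(b ^ 2) / 4) ≤ Real.exp (-(a ^ 2) / 4) := by
    apply Real.exp_le_exp.2; nlinarith
  have h2 : Real.exp (-(a ^ 2) / 4) ≤ Real.exp (-(m ^ 2) / 4) := by
    apply Real.exp_le_exp.2; nlinarith
  rw [abs_of_nonneg (by linarith), abs_of_nonpos (by linarith)]
  have h3 : Real.exp (-(b ^ 2) / 4) =
      Real.exp (-(a ^ 2) / 4) * Real.exp (-((b ^ 2 - a ^ 2) / 4)) := by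
    rw [← Real.exp_add]; congr 1; ring
  have h4 := Real.add_one_le_exp (-((b ^ 2 - a ^ 2) / 4))
  have h5 : Real.exp (-(a ^ 2) / 4) - Real.exp (-(b ^ 2) / 4) ≤
      Real.exp (-(a ^ 2) / 4) * ((b ^ 2 - a ^ 2) / 4) := by
    rw [h3]; nlinarith [Real.exp_pos (-(a ^ 2) / 4)]
  have h6 : (b ^ 2 - a ^ 2) / 4 ≤ M / 2 * (b - a) := by nlinarith
  calc _ ≤ _ := h5
    _ ≤ Real.exp (-(m ^ 2) / 4) * (M / 2 * (b - a)) := by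
        apply mul_le_mul h2 h6 (by nlinarith) (Real.exp_pos _).le
    _ = _ := by ring

lemma aux_exp_eq {C ρ : ℝ} :
    Real.exp (-((1 / (C * ρ)) ^ 2) / 4) = Real.exp (-1 / (4 * C ^ 2 * ρ ^ 2)) := by
  congr 1
  rw [div_pow, mul_pow, one_pow, neg_div, neg_div, div_div]; congr 2; ring

lemma aux_scaled {n : ℕ} (hn : 2 ≤ n) {V : Type*} [NormedAddCommGroup V] [NormedSpace ℝ V]
    {C D L ρ : ℝ} (hC : 1 < C) (hD : 0 ≤ D) (hL : 0 ≤ L) (hρ : 0 < ρ) (hρ1 : ρ < 1)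
    (F : Euc n × Euc n → V)
    (hF0 : ∀ x : Euc n × Euc n, x.2 ∈ Sph n →
      x.1 ∉ Metric.ball (0 : Euc n) C \ Metric.closedBall (0 : Euc n) (1 / C) → F x = 0)
    (hFD : ∀ x : Euc n × Euc n, x.2 ∈ Sph n → ‖F x‖ ≤ D)
    (hFL : ∀ x y : Euc n × Euc n, x.2 ∈ Sph n → y.2 ∈ Sph n → ‖F x - F y‖ ≤ L * dist x y)
    (f : Euc n × Euc n → V)
    (hf : ∀ x, f x = (ρ ^ n * Real.exp (-(‖x.1‖ ^ 2) / 4)) • F (ρ • x.1, x.2)) :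
    (∀ x : Euc n × Euc n, x.2 ∈ Sph n →
      (1 + ‖x.1‖) * ‖f x‖ ≤ C * ρ ^ (n - 1) * Real.exp (-1 / (4 * C ^ 2 * ρ ^ 2)) * (2 * D)) ∧
    (∀ x y : Euc n × Euc n, x.2 ∈ Sph n → y.2 ∈ Sph n →
      ‖f x - f y‖ ≤ C * ρ ^ (n - 1) * Real.exp (-1 / (4 * C ^ 2 * ρ ^ 2)) * (D + L) * dist x y) := by
  have hρn : ρ ^ n = ρ ^ (n - 1) * ρ := by
    rw [← pow_succ]; congr 1; omega
  have hC0 : 0 < C := by linarith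
  set E := Real.exp (-1 / (4 * C ^ 2 * ρ ^ 2)) with hE
  have hE0 : 0 < E := Real.exp_pos _
  have hP0 : 0 < ρ ^ (n - 1) := pow_pos hρ _
  set P := ρ ^ (n - 1) with hP
  have hm0 : (0:ℝ) ≤ 1 / (C * ρ) := by positivity
  have hann : ∀ p : Euc n, ρ • p ∈ Metric.ball (0 : Euc n) C \ Metric.closedBall (0 : Euc n) (1 / C) →
      1 / (C * ρ) ≤ ‖p‖ ∧ ‖p‖ ≤ C / ρ := by
    intro p hp
    simp only [Set.mem_sdiff, mem_ball_zero_iff, mem_closedBall_zero_iff, norm_smul,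
      Real.norm_eq_abs, abs_of_pos hρ, not_le] at hp
    constructor
    · rw [div_le_iff₀ (by positivity)]
      have := hp.2
      rw [div_lt_iff₀ hC0] at this
      linarith
    · rw [le_div_iff₀ hρ]; linarith [hp.1]
  have hw : ∀ p : Euc n, 1 / (C * ρ) ≤ ‖p‖ → Real.exp (-(‖p‖ ^ 2) / 4) ≤ E := by
    intro p hp
    rw [hE, ← aux_exp_eq]
    apply Real.exp_le_exp.2
    have := pow_le_pow_left₀ hm0 hp 2
    linarith
  have hfn : ∀ x, ‖f x‖ = P * ρ * Real.exp (-(‖x.1‖ ^ 2) / 4) * ‖F (ρ • x.1, x.2)‖ := by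
    intro x
    rw [hf, norm_smul, Real.norm_eq_abs, abs_of_pos (by positivity), hρn]
  have hdist : ∀ x y : Euc n × Euc n, dist ((ρ • x.1, x.2) : Euc n × Euc n) (ρ • y.1, y.2) ≤ dist x y := by
    intro x y
    rw [Prod.dist_eq, Prod.dist_eq]
    apply max_le_max _ le_rfl
    simp only [dist_smul₀, Real.norm_eq_abs, abs_of_pos hρ]
    nlinarith [dist_nonneg (x := x.1) (y := y.1)]
  constructor
  · intro x hx
    by_cases h : ρ • x.1 ∈ Metric.ball (0 : Euc n) C \ Metric.closedBall (0 : Euc n) (1 / C)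
    · obtain ⟨h1, h2⟩ := hann _ h
      have h3 := hw _ h1
      have h4 := hFD (ρ • x.1, x.2) hx
      have h5 : ρ * ‖x.1‖ ≤ C := by rw [le_div_iff₀ hρ] at h2; linarith
      rw [hfn]
      calc _ = P * ((ρ + ρ * ‖x.1‖) * (Real.exp (-(‖x.1‖ ^ 2) / 4) * ‖F (ρ • x.1, x.2)‖)) := by ring
        _ ≤ P * ((2 * C) * (E * D)) := by gcongr; linarith
        _ = _ := by ring
    · rw [hfn, hF0 (ρ • x.1, x.2) hx h]; simp; positivity
  · have key : ∀ x y : Euc n × Euc n, x.2 ∈ Sph n → y.2 ∈ Sph n →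
      ρ • x.1 ∈ Metric.ball (0 : Euc n) C \ Metric.closedBall (0 : Euc n) (1 / C) →
      ‖f x - f y‖ ≤ C * P * E * (D + L) * dist x y := by
      intro x y hx hy h
      obtain ⟨h1, h2⟩ := hann _ h
      have hwx := hw _ h1
      have hL' : ‖F (ρ • x.1, x.2) - F (ρ • y.1, y.2)‖ ≤ L * dist x y :=
        (hFL (ρ • x.1, x.2) (ρ • y.1, y.2) hx hy).trans (mul_le_mul_of_nonneg_left (hdist x y) hL)
      have e1 : f x - f y = (P * ρ * Real.exp (-(‖x.1‖ ^ 2) / 4)) •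
          (F (ρ • x.1, x.2) - F (ρ • y.1, y.2)) +
          (P * ρ * (Real.exp (-(‖x.1‖ ^ 2) / 4) - Real.exp (-(‖y.1‖ ^ 2) / 4))) •
            F (ρ • y.1, y.2) := by
        rw [hf, hf, hρn]; module
      have t1 : ‖(P * ρ * Real.exp (-(‖x.1‖ ^ 2) / 4)) •
          (F (ρ • x.1, x.2) - F (ρ • y.1, y.2))‖ ≤ C * P * E * L * dist x y := by
        rw [norm_smul, Real.norm_eq_abs, abs_of_pos (by positivity)]
        calc _ ≤ P * C * E * (L * dist x y) := by gcongr; linarith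
          _ = _ := by ring
      have t2 : ‖(P * ρ * (Real.exp (-(‖x.1‖ ^ 2) / 4) - Real.exp (-(‖y.1‖ ^ 2) / 4))) •
            F (ρ • y.1, y.2)‖ ≤ C * P * E * D * dist x y := by
        by_cases h' : ρ • y.1 ∈ Metric.ball (0 : Euc n) C \ Metric.closedBall (0 : Euc n) (1 / C)
        · obtain ⟨h3, h4⟩ := hann _ h'
          have h5 := aux_exp_s18 hm0 h1 h3 h2 h4
          rw [aux_exp_eq] at h5
          have h6 : |‖x.1‖ - ‖y.1‖| ≤ dist x y := by
            refine (abs_norm_sub_norm_le _ _).trans ?_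
            rw [← dist_eq_norm, Prod.dist_eq]; exact le_max_left _ _
          rw [norm_smul, norm_mul, Real.norm_eq_abs, Real.norm_eq_abs,
            abs_of_pos (mul_pos hP0 hρ)]
          calc _ ≤ P * ρ * (E * (C / ρ / 2) * dist x y) * D := by
                gcongr
                · exact h5.trans (by gcongr)
                · exact hFD _ hy
            _ = (C * P * E * D * dist x y) / 2 := by field_simp
            _ ≤ _ := by
              have : 0 ≤ C * P * E * D * dist x y := by positivity
              linarith
        · rw [hF0 (ρ • y.1, y.2) hy h']; simp; positivity
      rw [e1]
      refine (norm_add_le _ _).trans ?_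
      nlinarith
    intro x y hx hy
    by_cases h : ρ • x.1 ∈ Metric.ball (0 : Euc n) C \ Metric.closedBall (0 : Euc n) (1 / C)
    · exact key x y hx hy h
    by_cases h' : ρ • y.1 ∈ Metric.ball (0 : Euc n) C \ Metric.closedBall (0 : Euc n) (1 / C)
    · rw [norm_sub_rev, dist_comm]; exact key y x hy hx h'
    · rw [hf, hf, hF0 (ρ • x.1, x.2) hx h, hF0 (ρ • y.1, y.2) hy h']; simp; positivity

/-- Ambient gradient in the second variable. -/
def auxG {n : ℕ} (ψ : Euc n × Euc n → ℝ) (x : Euc n × Euc n) : Euc n :=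
  (InnerProductSpace.toDual ℝ (Euc n)).symm
    ((fderiv ℝ ψ x).comp (ContinuousLinearMap.inr ℝ (Euc n) (Euc n)))

/-- Tangential projection of the gradient. -/
def auxT {n : ℕ} (ψ : Euc n × Euc n → ℝ) (x : Euc n × Euc n) : Euc n :=
  auxG ψ x - ⟪auxG ψ x, x.2⟫ • x.2

lemma auxG_inner {n : ℕ} (ψ : Euc n × Euc n → ℝ) (x : Euc n × Euc n) :
    innerSL ℝ (auxG ψ x) =
      (fderiv ℝ ψ x).comp (ContinuousLinearMap.inr ℝ (Euc n) (Euc n)) := by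
  ext v
  simp [auxG]

lemma auxG_norm {n : ℕ} (ψ : Euc n × Euc n → ℝ) (x : Euc n × Euc n) :
    ‖auxG ψ x‖ ≤ ‖fderiv ℝ ψ x‖ := by
  rw [auxG, LinearIsometryEquiv.norm_map]
  refine (ContinuousLinearMap.opNorm_comp_le _ _).trans ?_
  exact mul_le_of_le_one_right (norm_nonneg _) (ContinuousLinearMap.norm_inr_le_one ℝ _ _)

lemma auxG_sub {n : ℕ} (ψ : Euc n × Euc n → ℝ) (x y : Euc n × Euc n) :
    ‖auxG ψ x - auxG ψ y‖ ≤ ‖fderiv ℝ ψ x - fderiv ℝ ψ y‖ := by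
  rw [auxG, auxG, ← map_sub, LinearIsometryEquiv.norm_map, ← ContinuousLinearMap.sub_comp]
  refine (ContinuousLinearMap.opNorm_comp_le _ _).trans ?_
  exact mul_le_of_le_one_right (norm_nonneg _) (ContinuousLinearMap.norm_inr_le_one ℝ _ _)

lemma aux_hasFDeriv {n : ℕ} {ψ : Euc n × Euc n → ℝ} (hψ : ContDiff ℝ 2 ψ) (p v : Euc n) :
    HasFDerivAt (fun w => ψ (p, w)) (innerSL ℝ (auxG ψ (p, v))) v := by
  rw [auxG_inner]
  exact ((hψ.differentiable (by norm_num)) (p, v)).hasFDerivAt.comp v (hasFDerivAt_prodMk_right p v)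

lemma auxT_bounds {n : ℕ} {ψ : Euc n × Euc n → ℝ} (hψ : ContDiff ℝ 2 ψ) {D : ℝ}
    (h1 : ∀ x, ‖fderiv ℝ ψ x‖ ≤ D) (h2 : ∀ x, ‖iteratedFDeriv ℝ 2 ψ x‖ ≤ D) :
    (∀ x : Euc n × Euc n, x.2 ∈ Sph n → ‖auxT ψ x‖ ≤ 2 * D) ∧
    (∀ x y : Euc n × Euc n, x.2 ∈ Sph n → y.2 ∈ Sph n →
      ‖auxT ψ x - auxT ψ y‖ ≤ 4 * D * dist x y) := by
  have hd : ∀ x y, ‖fderiv ℝ ψ x - fderiv ℝ ψ y‖ ≤ D * ‖x - y‖ := by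
    intro x y
    have hdiff : Differentiable ℝ (fderiv ℝ ψ) :=
      (hψ.fderiv_right (m := 1) (by norm_num)).differentiable (by norm_num)
    apply Convex.norm_image_sub_le_of_norm_fderiv_le (𝕜 := ℝ) (s := Set.univ)
      (fun z _ => hdiff z) _ convex_univ (Set.mem_univ _) (Set.mem_univ _)
    intro z _
    rw [← norm_iteratedFDeriv_one, norm_iteratedFDeriv_fderiv]
    exact h2 z
  have hG : ∀ x, ‖auxG ψ x‖ ≤ D := fun x => (auxG_norm ψ x).trans (h1 x)
  have hD : 0 ≤ D := (norm_nonneg _).trans (h1 0)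
  have hu : ∀ v : Euc n, v ∈ Sph n → ‖v‖ = 1 := by
    intro v hv; simpa [Sph] using hv
  constructor
  · intro x hx
    have hx := hu _ hx
    refine (norm_sub_le _ _).trans ?_
    rw [norm_smul, hx]
    have := norm_inner_le_norm (𝕜 := ℝ) (auxG ψ x) x.2
    rw [hx] at this
    linarith [hG x]
  · intro x y hx hy
    have hx := hu _ hx
    have hy := hu _ hy
    have g1 : ‖auxG ψ x - auxG ψ y‖ ≤ D * dist x y := by
      rw [dist_eq_norm]; exact (auxG_sub ψ x y).trans (hd x y)
    have g2 : ‖x.2 - y.2‖ ≤ dist x y := by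
      rw [← dist_eq_norm, Prod.dist_eq]; exact le_max_right _ _
    have e : auxT ψ x - auxT ψ y = (auxG ψ x - auxG ψ y) -
        (⟪auxG ψ x - auxG ψ y, x.2⟫ • x.2 + ⟪auxG ψ y, x.2 - y.2⟫ • x.2
          + ⟪auxG ψ y, y.2⟫ • (x.2 - y.2)) := by
      simp only [auxT, inner_sub_left, inner_sub_right]; module
    have i1 := norm_inner_le_norm (𝕜 := ℝ) (auxG ψ x - auxG ψ y) x.2
    have i2 := norm_inner_le_norm (𝕜 := ℝ) (auxG ψ y) (x.2 - y.2)
    have i3 := norm_inner_le_norm (𝕜 := ℝ) (auxG ψ y) y.2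
    rw [hx, mul_one] at i1
    rw [hy, mul_one] at i3
    rw [e]
    refine (norm_sub_le _ _).trans ?_
    refine (add_le_add_right (norm_add₃_le) _).trans ?_
    rw [norm_smul, norm_smul, norm_smul, hx]
    have j2 : ‖auxG ψ y‖ * ‖x.2 - y.2‖ ≤ D * dist x y := by
      gcongr; exact hG y
    have j3 : ‖⟪auxG ψ y, y.2⟫‖ * ‖x.2 - y.2‖ ≤ D * dist x y := by
      gcongr; exact i3.trans (hG y)
    linarith

lemma aux_sphereGrad {n : ℕ} {ψ : Euc n × Euc n → ℝ} (hψ : ContDiff ℝ 2 ψ) (p v : Euc n)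
    (hv : v ∈ Sph n) :
    HasFDerivWithinAt (fun w => ψ (p, w)) (innerSL ℝ (auxT ψ (p, v))) (Sph n) v := by
  have h := aux_hasFDeriv hψ p v
  have hs : HasFDerivAt (fun w : Euc n => ‖w‖ ^ 2) (2 • innerSL ℝ v) v :=
    (hasStrictFDerivAt_norm_sq v).hasFDerivAt
  set k := ⟪auxG ψ (p, v), v⟫ with hk
  have h2 := (h.sub ((hs.sub_const 1).const_mul (k / 2))).hasFDerivWithinAt (s := Sph n)
  have h3 := h2.congr (f₁ := fun w => ψ (p, w)) (by
    intro w hw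
    have : ‖w‖ = 1 := by simpa [Sph] using hw
    simp [this]) (by
    have : ‖v‖ = 1 := by simpa [Sph] using hv
    simp [this])
  have e : innerSL ℝ (auxT ψ (p, v)) =
      innerSL ℝ (auxG ψ (p, v)) - (k / 2) • (2 • innerSL ℝ v) := by
    apply ContinuousLinearMap.ext
    intro w
    simp [auxT, inner_sub_left, inner_smul_left, ← hk]
    ring
  rw [e]
  exact h3

lemma aux_nsup_nonneg {n : ℕ} {F : Type*} [NormedAddCommGroup F] (Y : Set (Euc n))
    (f : Euc n × Euc n → F) : 0 ≤ LipNorm Y f := by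
  apply add_nonneg
  · apply Real.sSup_nonneg
    rintro _ ⟨x, _, rfl⟩; exact norm_nonneg _
  · exact Real.sInf_nonneg fun x hx => hx.1

lemma aux_LipNorm_le {n : ℕ} {F : Type*} [NormedAddCommGroup F]
    (f : Euc n × Euc n → F) {A B : ℝ} (hA : 0 ≤ A) (hB : 0 ≤ B)
    (h1 : ∀ x : Euc n × Euc n, x.2 ∈ Sph n → (1 + ‖x.1‖) * ‖f x‖ ≤ A)
    (h2 : ∀ x y : Euc n × Euc n, x.2 ∈ Sph n → y.2 ∈ Sph n → ‖f x - f y‖ ≤ B * dist x y) :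
    IsBddLip Set.univ f ∧ LipNorm Set.univ f ≤ A + B := by
  have h1' : ∀ x ∈ pts (Set.univ : Set (Euc n)), ‖f x‖ ≤ A := by
    intro x hx
    refine le_trans ?_ (h1 x hx.2)
    nlinarith [norm_nonneg x.1, norm_nonneg (f x), mul_nonneg (norm_nonneg x.1) (norm_nonneg (f x))]
  have hl : B ∈ lipSet Set.univ f := ⟨hB, fun x hx y hy => h2 x y hx.2 hy.2⟩
  refine ⟨⟨⟨A, h1'⟩, ⟨B, hl⟩⟩, add_le_add ?_ ?_⟩
  · apply Real.sSup_le _ hA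
    rintro _ ⟨x, hx, rfl⟩; exact h1' x hx
  · exact csInf_le ⟨0, fun x hx => hx.1⟩ hl

/-- There is a constant `K > 0`, depending only on `n`, so that for any
`C > 1` and any `C²` function `ψ` on `(ℝ^{n+1} ∖ {0}) × 𝕊ⁿ` with compact support contained
in `(B_C ∖ B̄_{1/C}) × 𝕊ⁿ` and `C²`-norm at most `D`, the rescaled functions
`ψ_ρ(p,v) = ρⁿ e^{-|p|²/4} ψ(ρp, v)` (for `ρ ∈ (0,1)`) lie in `𝔛(ℝ^{n+1})` with
`‖ψ_ρ‖_𝔛 ≤ K C ρ^{n-1} e^{-1/(4C²ρ²)} D`. -/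
theorem rescaled_XNorm_bound (n : ℕ) (hn : 2 ≤ n) :
    ∃ K : ℝ, 0 < K ∧
      ∀ C : ℝ, 1 < C →
      ∀ ψ : Euc n × Euc n → ℝ, ContDiff ℝ 2 ψ →
      (∀ x : Euc n × Euc n,
        x.1 ∉ Metric.ball (0 : Euc n) C \ Metric.closedBall (0 : Euc n) (1 / C) →
        ψ x = 0) →
      ∀ D : ℝ,
      (∀ x : Euc n × Euc n,
        |ψ x| ≤ D ∧ ‖fderiv ℝ ψ x‖ ≤ D ∧ ‖iteratedFDeriv ℝ 2 ψ x‖ ≤ D) →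
      ∀ ρ : ℝ, ρ ∈ Set.Ioo (0 : ℝ) 1 →
        memX (Set.univ : Set (Euc n))
          (fun x => ρ ^ n * Real.exp (-(‖x.1‖ ^ 2) / 4) * ψ (ρ • x.1, x.2)) ∧
        XNorm (Set.univ : Set (Euc n))
          (fun x => ρ ^ n * Real.exp (-(‖x.1‖ ^ 2) / 4) * ψ (ρ • x.1, x.2)) ≤
          K * C * ρ ^ (n - 1) * Real.exp (-1 / (4 * C ^ 2 * ρ ^ 2)) * D := by
  refine ⟨20, by norm_num, ?_⟩
  intro C hC ψ hψ h0 D hD ρ ⟨hρ, hρ1⟩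
  have hD0 : 0 ≤ D := (abs_nonneg _).trans (hD 0).1
  obtain ⟨T1, T2⟩ := auxT_bounds hψ (fun x => (hD x).2.1) (fun x => (hD x).2.2)
  have hψL : ∀ x y, ‖ψ x - ψ y‖ ≤ D * dist x y := by
    intro x y
    rw [dist_eq_norm]
    exact Convex.norm_image_sub_le_of_norm_fderiv_le (𝕜 := ℝ) (s := Set.univ)
      (fun z _ => (hψ.differentiable (by norm_num)) z) (fun z _ => (hD z).2.1) convex_univ
      (Set.mem_univ _) (Set.mem_univ _)
  have hT0 : ∀ x : Euc n × Euc n, x.2 ∈ Sph n →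
      x.1 ∉ Metric.ball (0 : Euc n) C \ Metric.closedBall (0 : Euc n) (1 / C) →
      auxT ψ x = 0 := by
    intro x _ hx
    have h := aux_hasFDeriv hψ x.1 x.2
    have hz : (fun w => ψ (x.1, w)) = fun _ => (0 : ℝ) := by
      funext w; exact h0 (x.1, w) hx
    rw [hz] at h
    have h' := h.unique (hasFDerivAt_const (0 : ℝ) x.2)
    have hG : auxG ψ x = 0 := by
      rw [← norm_eq_zero, ← innerSL_apply_norm (𝕜 := ℝ) (auxG ψ x)]
      have : innerSL ℝ (auxG ψ x) = 0 := h'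
      rw [this, norm_zero]
    simp [auxT, hG]
  set f : Euc n × Euc n → ℝ :=
    fun x => ρ ^ n * Real.exp (-(‖x.1‖ ^ 2) / 4) * ψ (ρ • x.1, x.2) with hf
  set g : Euc n × Euc n → Euc n :=
    fun x => (ρ ^ n * Real.exp (-(‖x.1‖ ^ 2) / 4)) • auxT ψ (ρ • x.1, x.2) with hg
  obtain ⟨a1, a2⟩ := aux_scaled hn hC hD0 hD0 hρ hρ1 ψ (fun x _ => h0 x) (fun x _ => (hD x).1)
    (fun x y _ _ => hψL x y) f (fun x => rfl)
  obtain ⟨b1, b2⟩ := aux_scaled hn hC (by linarith : 0 ≤ 2 * D) (by linarith : 0 ≤ 4 * D) hρ hρ1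
    (auxT ψ) hT0 T1 T2 g (fun x => rfl)
  have hQ : 0 ≤ C * ρ ^ (n - 1) * Real.exp (-1 / (4 * C ^ 2 * ρ ^ 2)) := by
    have : 0 < C := by linarith
    positivity
  set Q := C * ρ ^ (n - 1) * Real.exp (-1 / (4 * C ^ 2 * ρ ^ 2)) with hQdef
  obtain ⟨c1, c2⟩ := aux_LipNorm_le f (by positivity) (by positivity) a1 a2
  obtain ⟨d1, d2⟩ := aux_LipNorm_le g (by positivity) (by positivity) b1 b2
  have hgr : IsSphereGrad Set.univ f g := by
    intro x hx
    have hx2 : ‖x.2‖ = 1 := by simpa [pts, Sph] using hx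
    constructor
    · simp [hg, auxT, inner_smul_left, inner_sub_left, hx2]
    · have h := (aux_sphereGrad hψ (ρ • x.1) x.2 hx.2).const_mul
        (ρ ^ n * Real.exp (-(‖x.1‖ ^ 2) / 4))
      have e : innerSL ℝ (g x) =
          (ρ ^ n * Real.exp (-(‖x.1‖ ^ 2) / 4)) • innerSL ℝ (auxT ψ (ρ • x.1, x.2)) := by
        apply ContinuousLinearMap.ext
        intro w
        simp [hg, inner_smul_left]
      rw [e]
      exact h
  refine ⟨⟨c1, g, hgr, d1, _, fun x hx => b1 x hx.2⟩, ?_⟩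
  have e1 : gradWsup Set.univ g ≤ Q * (2 * (2 * D)) := by
    apply Real.sSup_le _ (by positivity)
    rintro _ ⟨x, hx, rfl⟩; exact b1 x hx.2
  have e2 : XNorm Set.univ f ≤ LipNorm Set.univ f + LipNorm Set.univ g + gradWsup Set.univ g := by
    apply csInf_le
    · refine ⟨0, ?_⟩
      rintro _ ⟨g', _, rfl⟩
      refine add_nonneg (add_nonneg (aux_nsup_nonneg _ _) (aux_nsup_nonneg _ _)) ?_
      apply Real.sSup_nonneg
      rintro _ ⟨x, _, rfl⟩
      positivity
    · exact ⟨g, hgr, rfl⟩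
  have e3 : 20 * C * ρ ^ (n - 1) * Real.exp (-1 / (4 * C ^ 2 * ρ ^ 2)) * D = 20 * (Q * D) := by
    rw [hQdef]; ring
  rw [e3]
  have : 0 ≤ Q * D := by positivity
  nlinarith
end
end

section
/- Let n ≥ 2, let Y ⊆ ℝ^{n+1} be nonempty, and let Φ : Y → Y be a map satisfying sup_{p∈Y} | |Φ(p)|² − |p|² | ≤ M̃₀ for some constant M̃₀ > 0. Then for every ξ ∈ 𝔚(Y) and every map V : Y × S^n → S^n such that the function η(p,v) = ξ(Φ(p), V(p,v)) is continuous on Y × S^n, one has η ∈ 𝔚(Y) with ‖η‖_𝔚 ≤ 4^{n+1}(1 + M̃₀^{1/2})^{n+1} e^{M̃₀/4} ‖ξ‖_𝔚; in particular, sup_{p∈Y} (1+|p|)/(1+|Φ(p)|) ≤ 4(1 + M̃₀^{1/2}). -/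
/- Function spaces 𝔚, 𝔛, 𝔜′, 𝔜₀, 𝔜 on `Y × 𝕊ⁿ` from Bernstein–Wang,
"A mountain-pass theorem for asymptotically conical self-expanders". -/

noncomputable section

open Set Metric Real Filter
open scoped RealInnerProductSpace

/-- Let `Y ⊆ ℝ^{n+1}` be nonempty and `Φ : Y → Y` with
`sup_Y ||Φ(p)|² − |p|²| ≤ M̃₀`. Then `sup_Y (1+|p|)/(1+|Φ(p)|) ≤ 4(1+√M̃₀)`, and for every
`ξ ∈ 𝔚(Y)` and every sphere-valued `V` such that `η(p,v) = ξ(Φ(p), V(p,v))` is continuous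
on `Y × 𝕊ⁿ`, one has `η ∈ 𝔚(Y)` with
`‖η‖_𝔚 ≤ 4^{n+1} (1+√M̃₀)^{n+1} e^{M̃₀/4} ‖ξ‖_𝔚`. -/
theorem W_composition_bound
    (n : ℕ) (hn : 2 ≤ n) (Y : Set (Euc n)) (hY : Y.Nonempty)
    (M₀ : ℝ) (hM₀ : 0 < M₀) (Φ : Euc n → Euc n)
    (hΦmaps : ∀ p ∈ Y, Φ p ∈ Y)
    (hΦ : ∀ p ∈ Y, |‖Φ p‖ ^ 2 - ‖p‖ ^ 2| ≤ M₀) :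
    (∀ p ∈ Y, (1 + ‖p‖) / (1 + ‖Φ p‖) ≤ 4 * (1 + Real.sqrt M₀)) ∧
    ∀ ξ : Euc n × Euc n → ℝ, memW Y ξ →
    ∀ V : Euc n × Euc n → Euc n, (∀ x ∈ pts Y, V x ∈ Sph n) →
    ContinuousOn (fun x => ξ (Φ x.1, V x)) (pts Y) →
      memW Y (fun x => ξ (Φ x.1, V x)) ∧
      WNorm Y (fun x => ξ (Φ x.1, V x)) ≤
        4 ^ (n + 1) * (1 + Real.sqrt M₀) ^ (n + 1) * Real.exp (M₀ / 4) * WNorm Y ξ := by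
  have h1 : ∀ p ∈ Y, (1 + ‖p‖) ≤ 4 * (1 + Real.sqrt M₀) * (1 + ‖Φ p‖) := by
    intro p hp
    have h := (abs_le.mp (hΦ p hp)).1
    have hs := Real.sq_sqrt hM₀.le
    have hs0 := Real.sqrt_nonneg M₀
    have hb := norm_nonneg (Φ p)
    have h2 : ‖p‖ ≤ ‖Φ p‖ + Real.sqrt M₀ := by
      refine (sq_le_sq₀ (norm_nonneg p) (by positivity)).mp ?_
      nlinarith [mul_nonneg hb hs0]
    nlinarith [mul_nonneg hb hs0]
  refine ⟨fun p hp => ?_, ?_⟩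
  · rw [div_le_iff₀ (by positivity)]
    exact h1 p hp
  intro ξ hξ V hV hc
  obtain ⟨_, M, hM⟩ := hξ
  have hbdd : BddAbove ((fun x => wWeight n x.1 * |ξ x|) '' pts Y) := by
    refine ⟨M, ?_⟩
    rintro _ ⟨x, hx, rfl⟩
    exact hM x hx
  have key : ∀ x ∈ pts Y, wWeight n x.1 * |ξ (Φ x.1, V x)| ≤
      4 ^ (n + 1) * (1 + Real.sqrt M₀) ^ (n + 1) * Real.exp (M₀ / 4) * WNorm Y ξ := by
    intro x hx
    have hx1 : x.1 ∈ Y := hx.1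
    have hmem : (Φ x.1, V x) ∈ pts Y := ⟨hΦmaps _ hx1, hV x hx⟩
    have hle : wWeight n (Φ x.1) * |ξ (Φ x.1, V x)| ≤ WNorm Y ξ :=
      le_csSup hbdd ⟨_, hmem, rfl⟩
    have hw : wWeight n x.1 ≤
        4 ^ (n + 1) * (1 + Real.sqrt M₀) ^ (n + 1) * Real.exp (M₀ / 4) * wWeight n (Φ x.1) := by
      unfold wWeight
      have ha : (1 + ‖x.1‖) ^ (n + 1) ≤ (4 * (1 + Real.sqrt M₀) * (1 + ‖Φ x.1‖)) ^ (n + 1) :=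
        pow_le_pow_left₀ (by positivity) (h1 _ hx1) _
      have hb : Real.exp (‖x.1‖ ^ 2 / 4) ≤ Real.exp (M₀ / 4) * Real.exp (‖Φ x.1‖ ^ 2 / 4) := by
        rw [← Real.exp_add]
        apply Real.exp_le_exp.mpr
        have h := (abs_le.mp (hΦ _ hx1)).1
        linarith
      calc _ ≤ _ := mul_le_mul ha hb (by positivity) (by positivity)
        _ = _ := by rw [mul_pow, mul_pow]; ring
    calc _ ≤ _ := mul_le_mul_of_nonneg_right hw (abs_nonneg _)
      _ = 4 ^ (n + 1) * (1 + Real.sqrt M₀) ^ (n + 1) * Real.exp (M₀ / 4) *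
          (wWeight n (Φ x.1) * |ξ (Φ x.1, V x)|) := by ring
      _ ≤ _ := mul_le_mul_of_nonneg_left hle (by positivity)
  refine ⟨⟨hc, _, key⟩, ?_⟩
  have h0 : 0 ≤ WNorm Y ξ := by
    apply Real.sSup_nonneg
    rintro _ ⟨x, _, rfl⟩
    simp only [wWeight]
    positivity
  apply Real.sSup_le
  · rintro _ ⟨x, hx, rfl⟩
    exact key x hx
  · positivity
end
end
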